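/- arXiv:math/0602023 — 3 statements merged into one kernel-verified Lean document; each statement's English description precedes it below -/
import Mathlib

section
/- Let p, q, r be pairwise relatively prime positive integers and let a, b, c be integers with aqr + bpr + cpq = 1. Let π be the group with presentation ⟨x, y, z, h | h x h⁻¹ x⁻¹ = 1, h y h⁻¹ y⁻¹ = 1, h z h⁻¹ z⁻¹ = 1, x^p = h^a, y^q = h^b, z^r = h^c, xyz = 1⟩ (the fundamental group of the Brieskorn homology sphere Σ(p,q,r)). Then for every irreducible representation ρ : π → SL₂(ℂ), the complex vector space Z¹(π; sl₂(ℂ)_{Ad ρ}) of 1-cocycles has dimension 3. -/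
abbrev SL2C := Matrix.SpecialLinearGroup (Fin 2) ℂ

/-- A representation `ρ : G → SL₂(ℂ)` is irreducible if the matrices `ρ g` have no
common eigenvector, i.e. there is no one-dimensional invariant subspace of `ℂ²`. -/
def IsIrreducibleRep {G : Type} [Group G] (ρ : G →* SL2C) : Prop :=
  ¬ ∃ v : Fin 2 → ℂ, v ≠ 0 ∧ ∀ g : G, ∃ c : ℂ,
    Matrix.mulVec (ρ g : Matrix (Fin 2) (Fin 2) ℂ) v = c • v

/-- The space `Z¹(G; sl₂(ℂ)_{Ad ρ})` of 1-cocycles: maps `u : G → sl₂(ℂ)` with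
`u (g h) = u g + ρ(g) u(h) ρ(g)⁻¹`, as a subspace of maps into trace-zero matrices. -/
noncomputable def cocycleSpace {G : Type} [Group G] (ρ : G →* SL2C) :
    Submodule ℂ (G → Matrix (Fin 2) (Fin 2) ℂ) where
  carrier := {u | (∀ g, Matrix.trace (u g) = 0) ∧
    ∀ g h : G, u (g * h) = u g +
      (ρ g : Matrix (Fin 2) (Fin 2) ℂ) * u h * (((ρ g)⁻¹ : SL2C) : Matrix (Fin 2) (Fin 2) ℂ)}
  add_mem' := by
    rintro u v ⟨hu1, hu2⟩ ⟨hv1, hv2⟩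
    refine ⟨fun g => by simp [hu1 g, hv1 g], fun g h => ?_⟩
    simp only [Pi.add_apply, hu2 g h, hv2 g h, mul_add, add_mul]
    abel
  zero_mem' := ⟨by simp, by simp⟩
  smul_mem' := by
    rintro c u ⟨hu1, hu2⟩
    refine ⟨fun g => by simp [hu1 g], fun g h => ?_⟩
    simp only [Pi.smul_apply, hu2 g h, smul_add, mul_smul_comm, smul_mul_assoc]

/-- The relations of the presentation
`⟨x, y, z, h ∣ h central, x^p = h^a, y^q = h^b, z^r = h^c, xyz = 1⟩` of the fundamental
group of the Brieskorn sphere `Σ(p,q,r)`; generators `x, y, z, h` are `0, 1, 2, 3`. -/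
def brieskornRels (p q r : ℕ) (a b c : ℤ) : Set (FreeGroup (Fin 4)) :=
  {FreeGroup.of 3 * FreeGroup.of 0 * (FreeGroup.of 3)⁻¹ * (FreeGroup.of 0)⁻¹,
   FreeGroup.of 3 * FreeGroup.of 1 * (FreeGroup.of 3)⁻¹ * (FreeGroup.of 1)⁻¹,
   FreeGroup.of 3 * FreeGroup.of 2 * (FreeGroup.of 3)⁻¹ * (FreeGroup.of 2)⁻¹,
   FreeGroup.of 0 ^ p * ((FreeGroup.of 3) ^ a)⁻¹,
   FreeGroup.of 1 ^ q * ((FreeGroup.of 3) ^ b)⁻¹,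
   FreeGroup.of 2 ^ r * ((FreeGroup.of 3) ^ c)⁻¹,
   FreeGroup.of 0 * FreeGroup.of 1 * FreeGroup.of 2}

open Matrix

section MatrixLemmas

/-- A matrix orthogonal to `1` and to a non-scalar `x` for the trace form is a commutator
with `x`. -/
theorem exists_traceless_commutator_eq {x y W : Matrix (Fin 2) (Fin 2) ℂ}
    (hxy : x * y ≠ y * x) (hW : W.trace = 0) (hxW : (x * W).trace = 0) :
    ∃ A : Matrix (Fin 2) (Fin 2) ℂ, A.trace = 0 ∧ A * x - x * A = W := by
  have hdiag : W 1 1 = - W 0 0 := by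
    rw [trace_fin_two] at hW; linear_combination hW
  simp only [trace_fin_two, mul_apply, Fin.sum_univ_two, hdiag] at hxW
  by_cases hβ : x 0 1 = 0
  · by_cases hγ : x 1 0 = 0
    · have hd : x 0 0 - x 1 1 ≠ 0 := by
        intro hd
        apply hxy
        have hd' : x 0 0 = x 1 1 := sub_eq_zero.mp hd
        ext i j
        fin_cases i <;> fin_cases j <;>
          simp [-cons_mul, mul_apply, Fin.sum_univ_two, hβ, hγ, hd'] <;> ring
      have hw : W 0 0 = 0 := by
        rw [hβ, hγ] at hxW
        have : (x 0 0 - x 1 1) * W 0 0 = 0 := by linear_combination hxW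
        exact (mul_eq_zero.mp this).resolve_left hd
      refine ⟨!![0, -W 0 1 / (x 0 0 - x 1 1); W 1 0 / (x 0 0 - x 1 1), 0],
        by simp [trace_fin_two], ?_⟩
      ext i j
      fin_cases i <;> fin_cases j <;>
        simp [-cons_mul, mul_apply, Fin.sum_univ_two, hβ, hγ, hdiag, hw] <;> field_simp <;> ring
    · refine ⟨!![-W 1 0 / (2 * x 1 0), W 0 0 / x 1 0; 0, W 1 0 / (2 * x 1 0)],
        by simp [trace_fin_two]; ring, ?_⟩
      ext i j
      fin_cases i <;> fin_cases j <;>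
        simp [-cons_mul, mul_apply, Fin.sum_univ_two, hdiag, hβ] <;> field_simp
      · ring
      · rw [hβ] at hxW
        linear_combination -hxW
      · ring
      · ring
  · refine ⟨!![W 0 1 / (2 * x 0 1), 0; -W 0 0 / x 0 1, -W 0 1 / (2 * x 0 1)],
      by simp [trace_fin_two]; ring, ?_⟩
    ext i j
    fin_cases i <;> fin_cases j <;>
      simp [-cons_mul, mul_apply, Fin.sum_univ_two, hdiag] <;> field_simp
    · ring
    · ring
    · linear_combination -2 * hxW
    · ring

/-- A matrix orthogonal to `1`, `x` and `y` for the trace form is a multiple of the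
commutator of `x` and `y`, as soon as the latter is non-zero. -/
theorem exists_eq_smul_commutator {x y W : Matrix (Fin 2) (Fin 2) ℂ}
    (hxy : x * y ≠ y * x) (hW : W.trace = 0) (hxW : (x * W).trace = 0)
    (hyW : (y * W).trace = 0) : ∃ t : ℂ, W = t • (x * y - y * x) := by
  have hdiag : W 1 1 = - W 0 0 := by
    rw [trace_fin_two] at hW; linear_combination hW
  simp only [trace_fin_two, mul_apply, Fin.sum_univ_two, hdiag] at hxW hyW
  set c₁ := x 0 1 * y 1 0 - y 0 1 * x 1 0 with hc₁
  set c₂ := x 0 0 * y 0 1 + x 0 1 * y 1 1 - y 0 0 * x 0 1 - y 0 1 * x 1 1 with hc₂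
  set c₃ := x 1 0 * y 0 0 + x 1 1 * y 1 0 - y 1 0 * x 0 0 - y 1 1 * x 1 0 with hc₃
  have hC : x * y - y * x = !![c₁, c₂; c₃, -c₁] := by
    ext i j
    fin_cases i <;> fin_cases j <;>
      simp [-cons_mul, mul_apply, Fin.sum_univ_two, hc₁, hc₂, hc₃] <;> ring
  have h₁₂ : W 0 0 * c₂ = W 0 1 * c₁ := by
    rw [hc₁, hc₂]; linear_combination y 0 1 * hxW - x 0 1 * hyW
  have h₁₃ : W 0 0 * c₃ = W 1 0 * c₁ := by
    rw [hc₁, hc₃]; linear_combination -y 1 0 * hxW + x 1 0 * hyW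
  have h₂₃ : W 0 1 * c₃ = W 1 0 * c₂ := by
    rw [hc₂, hc₃]
    linear_combination (y 0 0 - y 1 1) * hxW - (x 0 0 - x 1 1) * hyW
  have key : ∀ s : ℂ, W 0 0 = s * c₁ → W 0 1 = s * c₂ → W 1 0 = s * c₃ →
      ∃ t : ℂ, W = t • (x * y - y * x) := by
    intro s h₁ h₂ h₃
    refine ⟨s, ?_⟩
    rw [hC]
    ext i j
    fin_cases i <;> fin_cases j <;> simp [h₁, h₂, h₃, hdiag]
  by_cases h1 : c₁ = 0
  · by_cases h2 : c₂ = 0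
    · by_cases h3 : c₃ = 0
      · refine absurd (sub_eq_zero.mp ?_) hxy
        rw [hC, h1, h2, h3]
        ext i j
        fin_cases i <;> fin_cases j <;> simp
      · refine key (W 1 0 / c₃) ?_ ?_ ?_ <;> field_simp <;> assumption
    · refine key (W 0 1 / c₂) ?_ ?_ ?_ <;> field_simp
      · exact h₁₂
      · exact h₂₃.symm
  · refine key (W 0 0 / c₁) ?_ ?_ ?_ <;> field_simp
    · exact h₁₂.symm
    · exact h₁₃.symm

/-- If `U` is orthogonal to `1` and `y` for the trace form, then so is `U * y` to `y`. -/
theorem trace_mul_mul_eq_zero {y U : Matrix (Fin 2) (Fin 2) ℂ}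
    (hU : U.trace = 0) (hyU : (y * U).trace = 0) : (y * (U * y)).trace = 0 := by
  have hdiag : U 1 1 = - U 0 0 := by
    rw [trace_fin_two] at hU; linear_combination hU
  simp only [trace_fin_two, mul_apply, Fin.sum_univ_two, hdiag] at hyU ⊢
  linear_combination (y 0 0 + y 1 1) * hyU

end MatrixLemmas

section Cocycles

variable {G : Type} [Group G] {ρ : G →* SL2C}

theorem coe_rep_mul (g k : G) : (ρ (g * k) : Matrix (Fin 2) (Fin 2) ℂ) = ρ g * ρ k := by
  rw [map_mul]
  rfl

theorem coe_rep_mul_inv (g : G) :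
    (ρ g : Matrix (Fin 2) (Fin 2) ℂ) * (((ρ g)⁻¹ : SL2C) : Matrix (Fin 2) (Fin 2) ℂ) = 1 :=
  congrArg Subtype.val (mul_inv_cancel (ρ g))

theorem coe_rep_inv_mul (g : G) :
    (((ρ g)⁻¹ : SL2C) : Matrix (Fin 2) (Fin 2) ℂ) * (ρ g : Matrix (Fin 2) (Fin 2) ℂ) = 1 :=
  congrArg Subtype.val (inv_mul_cancel (ρ g))

theorem coe_inv_rep_mul (g k : G) :
    (((ρ (g * k))⁻¹ : SL2C) : Matrix (Fin 2) (Fin 2) ℂ) =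
      (((ρ k)⁻¹ : SL2C) : Matrix (Fin 2) (Fin 2) ℂ) *
        (((ρ g)⁻¹ : SL2C) : Matrix (Fin 2) (Fin 2) ℂ) := by
  rw [map_mul, _root_.mul_inv_rev]
  rfl

/-- Schur's lemma for two-dimensional representations. -/
theorem IsIrreducibleRep.exists_eq_smul_one (hρ : IsIrreducibleRep ρ)
    {M : Matrix (Fin 2) (Fin 2) ℂ}
    (hM : ∀ g, M * (ρ g : Matrix (Fin 2) (Fin 2) ℂ) = ρ g * M) :
    ∃ μ : ℂ, M = μ • (1 : Matrix (Fin 2) (Fin 2) ℂ) := by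
  obtain ⟨μ, hμ⟩ := Module.End.exists_eigenvalue (Matrix.toLin' M)
  obtain ⟨v, hv⟩ := hμ.exists_hasEigenvector
  have hMv : M *ᵥ v = μ • v := by simpa using hv.apply_eq_smul
  refine ⟨μ, ?_⟩
  by_contra hne
  refine hρ ⟨v, hv.2, fun g => ?_⟩
  set w := (ρ g : Matrix (Fin 2) (Fin 2) ℂ) *ᵥ v with hw
  have hMw : M *ᵥ w = μ • w := by
    rw [hw, mulVec_mulVec, hM, ← mulVec_mulVec, hMv, mulVec_smul]
  by_cases hdet : v 0 * w 1 - v 1 * w 0 = 0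
  · by_cases h0 : v 0 = 0
    · have h1 : v 1 ≠ 0 := by
        intro h1
        exact hv.2 (by ext i; fin_cases i <;> simp [h0, h1])
      have hw0 : w 0 = 0 := by
        simpa [h0, h1] using hdet
      refine ⟨w 1 / v 1, ?_⟩
      ext i
      fin_cases i <;> simp [h0, hw0, h1]
    · refine ⟨w 0 / v 0, ?_⟩
      ext i
      fin_cases i
      · simp [h0]
      · simp only [Fin.mk_one, Pi.smul_apply, smul_eq_mul]
        field_simp
        linear_combination hdet
  · exfalso
    apply hne
    have e₁ := congrFun hMv
    have e₂ := congrFun hMw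
    simp only [mulVec, dotProduct, Fin.sum_univ_two, Pi.smul_apply, smul_eq_mul] at e₁ e₂
    have key : ∀ s t : ℂ, s * v 0 + t * v 1 = 0 → s * w 0 + t * w 1 = 0 → s = 0 ∧ t = 0 := by
      intro s t h₁ h₂
      constructor
      · refine (mul_eq_zero.mp ?_).resolve_right hdet
        linear_combination w 1 * h₁ - v 1 * h₂
      · refine (mul_eq_zero.mp ?_).resolve_right hdet
        linear_combination v 0 * h₂ - w 0 * h₁
    obtain ⟨h00, h01⟩ := key (M 0 0 - μ) (M 0 1) (by linear_combination e₁ 0)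
      (by linear_combination e₂ 0)
    obtain ⟨h10, h11⟩ := key (M 1 0) (M 1 1 - μ) (by linear_combination e₁ 1)
      (by linear_combination e₂ 1)
    ext i j
    fin_cases i <;> fin_cases j <;> simp [h01, h10, sub_eq_zero.mp h00, sub_eq_zero.mp h11]

theorem IsIrreducibleRep.eq_zero_of_commute (hρ : IsIrreducibleRep ρ)
    {M : Matrix (Fin 2) (Fin 2) ℂ} (hMt : M.trace = 0)
    (hM : ∀ g, M * (ρ g : Matrix (Fin 2) (Fin 2) ℂ) = ρ g * M) : M = 0 := by
  obtain ⟨μ, rfl⟩ := hρ.exists_eq_smul_one hM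
  have : μ = 0 := by simpa [trace_smul] using hMt
  simp [this]

/-- An irreducible two-dimensional representation has non-commutative image. -/
theorem IsIrreducibleRep.exists_not_commute (hρ : IsIrreducibleRep ρ) :
    ∃ g k, ρ g * ρ k ≠ ρ k * ρ g := by
  by_contra! hcomm
  refine hρ ⟨![1, 0], fun h => by simpa using congrFun h 0, fun g => ?_⟩
  obtain ⟨μ, hμ⟩ := hρ.exists_eq_smul_one (M := ρ g) fun k =>
    congrArg Subtype.val (hcomm g k)
  exact ⟨μ, by rw [hμ, smul_mulVec, one_mulVec]⟩

/-- The coboundary map, as a map from traceless matrices `!![a, b; c, -a]` to cocycles. -/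
noncomputable def coboundaryMap (ρ : G →* SL2C) : (Fin 3 → ℂ) →ₗ[ℂ] cocycleSpace ρ where
  toFun s := ⟨fun g => !![s 0, s 1; s 2, -s 0] - (ρ g : Matrix (Fin 2) (Fin 2) ℂ) *
      !![s 0, s 1; s 2, -s 0] * (((ρ g)⁻¹ : SL2C) : Matrix (Fin 2) (Fin 2) ℂ), by
    refine ⟨fun g => ?_, fun g k => ?_⟩
    · rw [trace_sub, trace_mul_cycle, coe_rep_inv_mul, one_mul, sub_self]
    · beta_reduce
      rw [coe_rep_mul, coe_inv_rep_mul]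
      noncomm_ring⟩
  map_add' s t := by
    ext1
    funext g
    have : !![(s + t) 0, (s + t) 1; (s + t) 2, -(s + t) 0] =
        !![s 0, s 1; s 2, -s 0] + !![t 0, t 1; t 2, -t 0] := by
      ext i j
      fin_cases i <;> fin_cases j <;> simp
      ring
    simp only [Submodule.coe_add, Pi.add_apply (f := (_ : G → Matrix (Fin 2) (Fin 2) ℂ)), this]
    noncomm_ring
  map_smul' r s := by
    ext1
    funext g
    have : !![(r • s) 0, (r • s) 1; (r • s) 2, -(r • s) 0] = r • !![s 0, s 1; s 2, -s 0] := by
      ext i j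
      fin_cases i <;> fin_cases j <;> simp
    simp only [this, RingHom.id_apply, Submodule.coe_smul, mul_smul_comm, smul_mul_assoc,
      ← smul_sub]
    rfl

theorem exists_coboundaryMap_apply_eq (ρ : G →* SL2C) {A : Matrix (Fin 2) (Fin 2) ℂ}
    (hA : A.trace = 0) : ∃ s, ∀ g, (coboundaryMap ρ s).1 g =
      A - (ρ g : Matrix (Fin 2) (Fin 2) ℂ) * A *
        (((ρ g)⁻¹ : SL2C) : Matrix (Fin 2) (Fin 2) ℂ) := by
  have hdiag : A 1 1 = - A 0 0 := by
    rw [trace_fin_two] at hA; linear_combination hA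
  have : !![A 0 0, A 0 1; A 1 0, -A 0 0] = A := by
    rw [← hdiag]; exact (eta_fin_two A).symm
  refine ⟨![A 0 0, A 0 1, A 1 0], fun g => ?_⟩
  conv_rhs => rw [← this]
  rfl

theorem coboundaryMap_injective (hρ : IsIrreducibleRep ρ) :
    Function.Injective (coboundaryMap ρ) := by
  rw [injective_iff_map_eq_zero]
  intro s hs
  have h0 : !![s 0, s 1; s 2, -s 0] = 0 := by
    refine hρ.eq_zero_of_commute (by simp [trace_fin_two]) fun g => ?_
    have h : !![s 0, s 1; s 2, -s 0] - (ρ g : Matrix (Fin 2) (Fin 2) ℂ) *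
      !![s 0, s 1; s 2, -s 0] * (((ρ g)⁻¹ : SL2C) : Matrix (Fin 2) (Fin 2) ℂ) = 0 :=
      congrFun (congrArg Subtype.val hs) g
    conv_lhs => rw [sub_eq_zero.mp h, mul_assoc, coe_rep_inv_mul, mul_one]
  ext i
  fin_cases i
  · simpa using congrFun (congrFun h0 0) 0
  · simpa using congrFun (congrFun h0 0) 1
  · simpa using congrFun (congrFun h0 1) 0

theorem cocycle_one {u : G → Matrix (Fin 2) (Fin 2) ℂ} (hu : u ∈ cocycleSpace ρ) :
    u 1 = 0 := by
  have h := hu.2 1 1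
  have hone : (ρ 1 : Matrix (Fin 2) (Fin 2) ℂ) = 1 := congrArg Subtype.val (map_one ρ)
  have hinv := coe_rep_mul_inv (ρ := ρ) 1
  rw [hone, one_mul] at hinv
  rw [mul_one, hone, hinv, one_mul, mul_one] at h
  exact left_eq_add.mp h

/-- The subgroup on which a cocycle vanishes. -/
def cocycleKer {u : G → Matrix (Fin 2) (Fin 2) ℂ} (hu : u ∈ cocycleSpace ρ) : Subgroup G where
  carrier := {g | u g = 0}
  mul_mem' {g k} hg hk := by
    simp only [Set.mem_ofPred_eq] at *
    rw [hu.2, hg, hk]; simp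
  one_mem' := cocycle_one hu
  inv_mem' {g} hg := by
    simp only [Set.mem_ofPred_eq] at *
    have h := hu.2 g⁻¹ g
    rw [hg, inv_mul_cancel, cocycle_one hu] at h
    simpa using h.symm

theorem cocycle_eq_zero_of_closure_eq_top {u : G → Matrix (Fin 2) (Fin 2) ℂ}
    (hu : u ∈ cocycleSpace ρ) {S : Set G} (hS : Subgroup.closure S = ⊤)
    (h : ∀ g ∈ S, u g = 0) : u = 0 := by
  funext g
  have : Subgroup.closure S ≤ cocycleKer hu := (Subgroup.closure_le _).mpr h
  exact this (hS ▸ Subgroup.mem_top g)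

theorem trace_mul_cocycle_pow {u : G → Matrix (Fin 2) (Fin 2) ℂ} (hu : u ∈ cocycleSpace ρ)
    (g : G) (n : ℕ) :
    ((ρ g : Matrix (Fin 2) (Fin 2) ℂ) * u (g ^ n)).trace = n * (ρ g * u g).trace := by
  induction n with
  | zero => simp [cocycle_one hu]
  | succ n ih =>
    have hc : (ρ g : Matrix (Fin 2) (Fin 2) ℂ) * ρ (g ^ n) = ρ (g ^ n) * ρ g := by
      rw [← coe_rep_mul, ← coe_rep_mul, ← pow_succ, ← pow_succ']
    rw [pow_succ, hu.2, mul_add, trace_add, ih, ← mul_assoc, ← mul_assoc, hc,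
      trace_mul_comm _ (((ρ (g ^ n))⁻¹ : SL2C) : Matrix (Fin 2) (Fin 2) ℂ), ← mul_assoc,
      ← mul_assoc, coe_rep_inv_mul, one_mul]
    push_cast
    ring

theorem trace_mul_cocycle_eq_zero {u : G → Matrix (Fin 2) (Fin 2) ℂ}
    (hu : u ∈ cocycleSpace ρ) {g : G} {n : ℕ} (hn : 0 < n) (hg : u (g ^ n) = 0) :
    ((ρ g : Matrix (Fin 2) (Fin 2) ℂ) * u g).trace = 0 := by
  have h := trace_mul_cocycle_pow hu g n
  rw [hg, mul_zero, trace_zero] at h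
  exact (mul_eq_zero.mp h.symm).resolve_left (by exact_mod_cast hn.ne')

theorem cocycle_eq_zero_of_central (hρ : IsIrreducibleRep ρ)
    {u : G → Matrix (Fin 2) (Fin 2) ℂ} (hu : u ∈ cocycleSpace ρ) {h : G}
    (hh : ∀ g, h * g = g * h) : u h = 0 := by
  obtain ⟨μ, hμ⟩ := hρ.exists_eq_smul_one (M := ρ h) fun g => by
    rw [← coe_rep_mul, ← coe_rep_mul, hh]
  refine hρ.eq_zero_of_commute (hu.1 h) fun g => ?_
  have e := congrArg u (hh g)
  have hconj : (ρ h : Matrix (Fin 2) (Fin 2) ℂ) * u g = u g * ρ h := by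
    rw [hμ]; simp
  rw [hu.2, hu.2, hconj, mul_assoc (u g), coe_rep_mul_inv, mul_one, add_comm] at e
  conv_lhs => rw [add_left_cancel e, mul_assoc, coe_rep_inv_mul, mul_one]

/-- Cocycles of an irreducible representation of a central extension of a quotient of a
triangle group form a three-dimensional space. -/
theorem finrank_cocycleSpace_eq_three (hρ : IsIrreducibleRep ρ) {x y h : G}
    (hgen : Subgroup.closure {x, y, h} = ⊤) (hhx : h * x = x * h) (hhy : h * y = y * h)
    {p q r : ℕ} (hp : 0 < p) (hq : 0 < q) (hr : 0 < r)
    (hxp : x ^ p ∈ Subgroup.zpowers h) (hyq : y ^ q ∈ Subgroup.zpowers h)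
    (hxyr : (x * y) ^ r ∈ Subgroup.zpowers h) :
    Module.finrank ℂ (cocycleSpace ρ) = 3 := by
  have hcentral : ∀ g, h * g = g * h := by
    intro g
    have hle : Subgroup.closure {x, y, h} ≤ Subgroup.centralizer {h} := by
      rw [Subgroup.closure_le]
      rintro k (rfl | rfl | rfl) <;> simp [Subgroup.mem_centralizer_singleton_iff, *]
    exact (Subgroup.mem_centralizer_singleton_iff.mp (hle (hgen ▸ Subgroup.mem_top g))).symm
  have hxy : (ρ x : Matrix (Fin 2) (Fin 2) ℂ) * ρ y ≠ ρ y * ρ x := by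
    intro hcomm
    have hcomm' : ρ x * ρ y = ρ y * ρ x := Subtype.ext (by simpa using hcomm)
    have hh' : ∀ g, ρ h * ρ g = ρ g * ρ h := fun g => by rw [← map_mul, hcentral, map_mul]
    have hext : ∀ s, ρ x * s = s * ρ x → ρ y * s = s * ρ y → ρ h * s = s * ρ h →
        ∀ g, ρ g * s = s * ρ g := by
      intro s hxs hys hhs g
      have hle : Subgroup.closure {x, y, h} ≤ (Subgroup.centralizer {s}).comap ρ := by
        rw [Subgroup.closure_le]
        rintro k (rfl | rfl | rfl) <;> simpa [Subgroup.mem_centralizer_singleton_iff]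
      exact Subgroup.mem_centralizer_singleton_iff.mp (hle (hgen ▸ Subgroup.mem_top g))
    have hx := hext (ρ x) rfl hcomm'.symm (hh' x)
    have hy := hext (ρ y) hcomm' rfl (hh' y)
    obtain ⟨g, k, hgk⟩ := hρ.exists_not_commute
    exact hgk (hext (ρ k) (hx k).symm (hy k).symm (hh' k) g)
  have hvanish : ∀ u ∈ cocycleSpace ρ, ∀ g ∈ Subgroup.zpowers h, u g = 0 := fun u hu g hg =>
    (Subgroup.zpowers_le (H := cocycleKer hu)).mpr
      (cocycle_eq_zero_of_central hρ hu hcentral) hg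
  have hsurj : Function.Surjective (coboundaryMap ρ) := by
    rintro ⟨u, hu⟩
    have htx := trace_mul_cocycle_eq_zero hu hp (hvanish u hu _ hxp)
    obtain ⟨A, hA, hAx⟩ := exists_traceless_commutator_eq (W := u x * ρ x) hxy
      (by rw [trace_mul_comm, htx]) (trace_mul_mul_eq_zero (hu.1 x) htx)
    obtain ⟨s, hs⟩ := exists_coboundaryMap_apply_eq ρ hA
    set v := u - (coboundaryMap ρ s).1 with hv_def
    have hv : v ∈ cocycleSpace ρ := sub_mem hu (coboundaryMap ρ s).2
    have hvx : v x = 0 := by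
      have : u x = A - ρ x * A * (((ρ x)⁻¹ : SL2C) : Matrix (Fin 2) (Fin 2) ℂ) := by
        calc u x = u x * ρ x * (((ρ x)⁻¹ : SL2C) : Matrix (Fin 2) (Fin 2) ℂ) := by
              rw [mul_assoc, coe_rep_mul_inv, mul_one]
          _ = _ := by rw [← hAx, sub_mul, mul_assoc A, coe_rep_mul_inv, mul_one]
      rw [hv_def, Pi.sub_apply, hs, this, sub_self]
    have hty := trace_mul_cocycle_eq_zero hv hq (hvanish v hv _ hyq)
    have htxy := trace_mul_cocycle_eq_zero hv hr (hvanish v hv _ hxyr)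
    rw [hv.2, hvx, zero_add, coe_rep_mul, ← mul_assoc, trace_mul_comm, ← mul_assoc,
      ← mul_assoc, ← mul_assoc, coe_rep_inv_mul, one_mul, trace_mul_comm, ← mul_assoc,
      trace_mul_comm] at htxy
    obtain ⟨t, ht⟩ := exists_eq_smul_commutator (W := v y * ρ y) hxy
      (by rw [trace_mul_comm, hty]) htxy
      (trace_mul_mul_eq_zero (hv.1 y) hty)
    set B : Matrix (Fin 2) (Fin 2) ℂ :=
      t • ((ρ x : Matrix (Fin 2) (Fin 2) ℂ) -
        ((ρ x : Matrix (Fin 2) (Fin 2) ℂ).trace / 2) • (1 : Matrix (Fin 2) (Fin 2) ℂ)) with hB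
    have hBtr : B.trace = 0 := by
      rw [hB]; simp [trace_smul, trace_sub]
    obtain ⟨s', hs'⟩ := exists_coboundaryMap_apply_eq ρ hBtr
    have hBx : (ρ x : Matrix (Fin 2) (Fin 2) ℂ) * B = B * ρ x := by
      rw [hB]; simp [mul_sub, sub_mul]
    have hBy : B * (ρ y : Matrix (Fin 2) (Fin 2) ℂ) - ρ y * B = v y * ρ y := by
      rw [ht, hB]; simp [mul_sub, sub_mul, ← smul_sub]
    have hvy : v y = B - ρ y * B * (((ρ y)⁻¹ : SL2C) : Matrix (Fin 2) (Fin 2) ℂ) := by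
      calc v y = v y * ρ y * (((ρ y)⁻¹ : SL2C) : Matrix (Fin 2) (Fin 2) ℂ) := by
            rw [mul_assoc, coe_rep_mul_inv, mul_one]
        _ = _ := by rw [← hBy, sub_mul, mul_assoc B, coe_rep_mul_inv, mul_one]
    have hw : v - (coboundaryMap ρ s').1 ∈ cocycleSpace ρ := sub_mem hv (coboundaryMap ρ s').2
    have hzero : v - (coboundaryMap ρ s').1 = 0 := by
      refine cocycle_eq_zero_of_closure_eq_top hw hgen ?_
      rintro g (rfl | rfl | rfl)
      · rw [Pi.sub_apply, hvx, hs', hBx, mul_assoc, coe_rep_mul_inv, mul_one, sub_self, sub_self]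
      · rw [Pi.sub_apply, hs', ← hvy, sub_self]
      · exact hvanish _ hw _ (Subgroup.mem_zpowers _)
    refine ⟨s + s', Subtype.ext ?_⟩
    rw [map_add, Submodule.coe_add, ← sub_eq_zero.mp hzero, hv_def]
    exact add_sub_cancel _ _
  rw [← (LinearEquiv.ofBijective (coboundaryMap ρ)
    ⟨coboundaryMap_injective hρ, hsurj⟩).finrank_eq, Module.finrank_fin_fun]

end Cocycles

/-- For an irreducible `SL₂(ℂ)` representation of the fundamental group of the
Brieskorn sphere `Σ(p,q,r)`, the space of 1-cocycles has dimension 3. -/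
theorem brieskorn_cocycles_dim_three (p q r : ℕ) (hp : 0 < p) (hq : 0 < q) (hr : 0 < r)
    (hpq : Nat.Coprime p q) (hpr : Nat.Coprime p r) (hqr : Nat.Coprime q r)
    (a b c : ℤ) (habc : a * q * r + b * p * r + c * p * q = 1)
    (ρ : PresentedGroup (brieskornRels p q r a b c) →* SL2C)
    (hρ : IsIrreducibleRep ρ) :
    Module.finrank ℂ (cocycleSpace ρ) = 3 := by
  set R := brieskornRels p q r a b c with hR
  let x : PresentedGroup R := PresentedGroup.of 0
  let y : PresentedGroup R := PresentedGroup.of 1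
  let z : PresentedGroup R := PresentedGroup.of 2
  let h : PresentedGroup R := PresentedGroup.of 3
  have rel : ∀ w ∈ R, PresentedGroup.mk R w = 1 := fun w hw =>
    PresentedGroup.one_of_mem hw
  have hhx : h * x * h⁻¹ * x⁻¹ = 1 := rel _ (by simp [hR, brieskornRels])
  have hhy : h * y * h⁻¹ * y⁻¹ = 1 := rel _ (by simp [hR, brieskornRels])
  have hxp : x ^ p * (h ^ a)⁻¹ = 1 :=
    rel (FreeGroup.of 0 ^ p * ((FreeGroup.of 3) ^ a)⁻¹) (by simp [hR, brieskornRels])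
  have hyq : y ^ q * (h ^ b)⁻¹ = 1 :=
    rel (FreeGroup.of 1 ^ q * ((FreeGroup.of 3) ^ b)⁻¹) (by simp [hR, brieskornRels])
  have hzr : z ^ r * (h ^ c)⁻¹ = 1 :=
    rel (FreeGroup.of 2 ^ r * ((FreeGroup.of 3) ^ c)⁻¹) (by simp [hR, brieskornRels])
  have hxyz : x * y * z = 1 := rel _ (by simp [hR, brieskornRels])
  have hz : x * y = z⁻¹ := eq_inv_of_mul_eq_one_left hxyz
  have hgen : Subgroup.closure {x, y, h} = ⊤ := by
    rw [eq_top_iff, ← PresentedGroup.closure_range_of R, Subgroup.closure_le]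
    have hx : x ∈ Subgroup.closure {x, y, h} := Subgroup.subset_closure (by simp)
    have hy : y ∈ Subgroup.closure {x, y, h} := Subgroup.subset_closure (by simp)
    have hh : h ∈ Subgroup.closure {x, y, h} := Subgroup.subset_closure (by simp)
    have hz' : z ∈ Subgroup.closure {x, y, h} :=
      inv_mem_iff.mp (hz ▸ mul_mem hx hy)
    rintro _ ⟨i, rfl⟩
    fin_cases i
    exacts [hx, hy, hz', hh]
  refine finrank_cocycleSpace_eq_three hρ hgen ?_ ?_ hp hq hr
    ⟨a, (mul_inv_eq_one.mp hxp).symm⟩ ⟨b, (mul_inv_eq_one.mp hyq).symm⟩ ?_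
  · exact mul_inv_eq_iff_eq_mul.mp (mul_inv_eq_one.mp hhx)
  · exact mul_inv_eq_iff_eq_mul.mp (mul_inv_eq_one.mp hhy)
  · rw [hz, inv_pow, mul_inv_eq_one.mp hzr]
    exact inv_mem (Subgroup.zpow_mem_zpowers h c)
end

section
/- Let p, q, r be pairwise relatively prime positive integers and let a, b, c be integers with aqr + bpr + cpq = 1. Let π be the group with presentation ⟨x, y, z, h | h x h⁻¹ x⁻¹ = 1, h y h⁻¹ y⁻¹ = 1, h z h⁻¹ z⁻¹ = 1, x^p = h^a, y^q = h^b, z^r = h^c, xyz = 1⟩ (the fundamental group of the Brieskorn homology sphere Σ(p,q,r)). Then the set of conjugacy classes of irreducible representations ρ : π → SL₂(ℂ) (under conjugation by elements of SL₂(ℂ)) is finite, of cardinality exactly (p−1)(q−1)(r−1)/4. -/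
/-- Conjugacy of irreducible representations: `ρ₂ = P ρ₁ P⁻¹` for some `P ∈ SL₂(ℂ)`. -/
def ConjRel {G : Type} [Group G]
    (ρ₁ ρ₂ : {ρ : G →* SL2C // IsIrreducibleRep ρ}) : Prop :=
  ∃ P : SL2C, ∀ g : G, ρ₂.1 g = P * ρ₁.1 g * P⁻¹

theorem sl2_inv_trace (M : SL2C) : Matrix.trace ((M⁻¹ : SL2C) : Matrix (Fin 2) (Fin 2) ℂ) =
    Matrix.trace (M : Matrix (Fin 2) (Fin 2) ℂ) := by
  rw [Matrix.SpecialLinearGroup.coe_inv, Matrix.adjugate_fin_two, Matrix.trace_fin_two,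
    Matrix.trace_fin_two]
  simp [add_comm]

/-- The stabiliser in `SL₂(ℂ)` of the line spanned by `v`. -/
def lineStabilizer (v : Fin 2 → ℂ) : Subgroup SL2C where
  carrier := {M | ∃ c : ℂ, Matrix.mulVec (M : Matrix (Fin 2) (Fin 2) ℂ) v = c • v}
  one_mem' := ⟨1, by simp⟩
  mul_mem' := by
    rintro M N ⟨c, hc⟩ ⟨d, hd⟩
    refine ⟨d * c, ?_⟩
    rw [Matrix.SpecialLinearGroup.coe_mul, ← Matrix.mulVec_mulVec, hd, Matrix.mulVec_smul, hc,
      smul_smul]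
  inv_mem' := by
    rintro M ⟨c, hc⟩
    have h : Matrix.mulVec ((M⁻¹ : SL2C) : Matrix (Fin 2) (Fin 2) ℂ)
        (Matrix.mulVec (M : Matrix (Fin 2) (Fin 2) ℂ) v) = v := by
      rw [Matrix.mulVec_mulVec, ← Matrix.SpecialLinearGroup.coe_mul]
      simp
    rw [hc, Matrix.mulVec_smul] at h
    rcases eq_or_ne c 0 with rfl | h0
    · refine ⟨0, ?_⟩
      rw [zero_smul] at h
      simp [← h]
    · exact ⟨c⁻¹, by rw [eq_inv_smul_iff₀ h0, h]⟩

theorem exists_mem_lineStabilizer_of_root (M : SL2C) (l : ℂ)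
    (hl : l ^ 2 - Matrix.trace (M : Matrix (Fin 2) (Fin 2) ℂ) * l + 1 = 0) :
    ∃ v : Fin 2 → ℂ, v ≠ 0 ∧ Matrix.mulVec (M : Matrix (Fin 2) (Fin 2) ℂ) v = l • v := by
  have hdet := M.det_coe
  rw [Matrix.det_fin_two] at hdet
  rw [Matrix.trace_fin_two] at hl
  have h0 : ((M : Matrix (Fin 2) (Fin 2) ℂ) - l • 1).det = 0 := by
    rw [Matrix.det_fin_two]
    simp
    linear_combination hl + hdet
  obtain ⟨v, hv, h⟩ := Matrix.exists_mulVec_eq_zero_iff.mpr h0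
  refine ⟨v, hv, ?_⟩
  rw [Matrix.sub_mulVec, Matrix.smul_mulVec, Matrix.one_mulVec, sub_eq_zero] at h
  exact h

theorem exists_root (t : ℂ) : ∃ l : ℂ, l ^ 2 - t * l + 1 = 0 := by
  obtain ⟨s, hs⟩ := IsAlgClosed.exists_pow_nat_eq (t ^ 2 - 4) (n := 2) (by norm_num)
  exact ⟨(t + s) / 2, by linear_combination hs / 4⟩

theorem exists_mem_lineStabilizer (M : SL2C) : ∃ v : Fin 2 → ℂ, v ≠ 0 ∧ M ∈ lineStabilizer v := by
  obtain ⟨l, hl⟩ := exists_root (Matrix.trace (M : Matrix (Fin 2) (Fin 2) ℂ))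
  obtain ⟨v, hv, h⟩ := exists_mem_lineStabilizer_of_root M l hl
  exact ⟨v, hv, l, h⟩

theorem mem_lineStabilizer_of_coe_eq_smul_one {M : SL2C} {c : ℂ}
    (h : (M : Matrix (Fin 2) (Fin 2) ℂ) = c • 1) (v : Fin 2 → ℂ) : M ∈ lineStabilizer v :=
  ⟨c, by rw [h, Matrix.smul_mulVec, Matrix.one_mulVec]⟩

theorem exists_smul_of_mulVec_eq_zero {N : Matrix (Fin 2) (Fin 2) ℂ} (hN : N ≠ 0)
    {v w : Fin 2 → ℂ} (hv : v ≠ 0) (hNv : N.mulVec v = 0) (hNw : N.mulVec w = 0) :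
    ∃ c : ℂ, w = c • v := by
  have hcross : v 0 * w 1 - v 1 * w 0 = 0 := by
    by_contra hc
    apply hN
    have h1 := fun i => congrFun hNv i
    have h2 := fun i => congrFun hNw i
    simp only [Matrix.mulVec, dotProduct, Fin.sum_univ_two, Pi.zero_apply] at h1 h2
    ext i j
    apply (mul_eq_zero.mp _).resolve_left hc
    fin_cases j <;> dsimp only [Fin.zero_eta, Fin.mk_one]
    · linear_combination w 1 * h1 i - v 1 * h2 i
    · linear_combination v 0 * h2 i - w 0 * h1 i
  by_cases h0 : v 0 = 0
  · have h1 : v 1 ≠ 0 := fun h1 => hv (by ext i; fin_cases i <;> simp [h0, h1])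
    refine ⟨w 1 / v 1, ?_⟩
    ext i
    fin_cases i
    · simp only [Fin.zero_eta, Pi.smul_apply, smul_eq_mul]
      field_simp
      linear_combination -hcross
    · simp [h1]
  · refine ⟨w 0 / v 0, ?_⟩
    ext i
    fin_cases i
    · simp [h0]
    · simp only [Fin.mk_one, Pi.smul_apply, smul_eq_mul]
      field_simp
      linear_combination hcross

/-- A matrix commuting with a non-scalar matrix preserves its eigenlines. -/
theorem mem_lineStabilizer_of_commute {M N : SL2C} (hcomm : Commute M N)
    (hM : ∀ c : ℂ, (M : Matrix (Fin 2) (Fin 2) ℂ) ≠ c • 1) {v : Fin 2 → ℂ} (hv : v ≠ 0)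
    (hMv : M ∈ lineStabilizer v) : N ∈ lineStabilizer v := by
  obtain ⟨c, hc⟩ := hMv
  have hker : ((M : Matrix (Fin 2) (Fin 2) ℂ) - c • 1).mulVec v = 0 := by
    rw [Matrix.sub_mulVec, Matrix.smul_mulVec, Matrix.one_mulVec, hc, sub_self]
  apply exists_smul_of_mulVec_eq_zero (sub_ne_zero.mpr (hM c)) hv hker
  rw [Matrix.sub_mulVec, Matrix.smul_mulVec, Matrix.one_mulVec, Matrix.mulVec_mulVec,
    ← Matrix.SpecialLinearGroup.coe_mul, hcomm.eq, Matrix.SpecialLinearGroup.coe_mul,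
    ← Matrix.mulVec_mulVec, hc, Matrix.mulVec_smul, sub_self]

theorem eq_one_or_neg_one_of_coe_eq_smul_one {M : SL2C} {c : ℂ}
    (h : (M : Matrix (Fin 2) (Fin 2) ℂ) = c • 1) : M = 1 ∨ M = -1 := by
  have hdet := M.det_coe
  rw [h, Matrix.det_smul, Matrix.det_one, mul_one, Fintype.card_fin, sq_eq_one_iff] at hdet
  rcases hdet with rfl | rfl
  · left; ext1; simp [h]
  · right; ext1; simp [h]

theorem sl2_mul_self (M : SL2C) : (M : Matrix (Fin 2) (Fin 2) ℂ) * M =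
    Matrix.trace (M : Matrix (Fin 2) (Fin 2) ℂ) • (M : Matrix (Fin 2) (Fin 2) ℂ) - 1 := by
  have hdet := M.det_coe
  rw [Matrix.det_fin_two] at hdet
  ext i j
  fin_cases i <;> fin_cases j <;>
    simp [Matrix.mul_apply, Fin.sum_univ_two, Matrix.trace_fin_two] <;>
    first | linear_combination -hdet | ring

/-- Two elements of `SL₂(ℂ)` without a common eigenvector can be put simultaneously in a
normal form depending only on an eigenvalue of the first and the traces. -/
theorem exists_normal_form {X Y : SL2C}
    (hXY : ∀ v : Fin 2 → ℂ, v ≠ 0 → X ∈ lineStabilizer v → Y ∉ lineStabilizer v) {l : ℂ}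
    (hl : l ^ 2 - Matrix.trace (X : Matrix (Fin 2) (Fin 2) ℂ) * l + 1 = 0) :
    ∃ P : SL2C,
      (X : Matrix (Fin 2) (Fin 2) ℂ) * P = P * !![l,
        Matrix.trace ((X * Y : SL2C) : Matrix (Fin 2) (Fin 2) ℂ) -
          (Matrix.trace (X : Matrix (Fin 2) (Fin 2) ℂ) - l) *
            Matrix.trace (Y : Matrix (Fin 2) (Fin 2) ℂ);
        0, Matrix.trace (X : Matrix (Fin 2) (Fin 2) ℂ) - l] ∧
      (Y : Matrix (Fin 2) (Fin 2) ℂ) * P =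
        P * !![0, -1; 1, Matrix.trace (Y : Matrix (Fin 2) (Fin 2) ℂ)] := by
  obtain ⟨v, hv, hXv⟩ := exists_mem_lineStabilizer_of_root X l hl
  have hYv : ∀ c : ℂ, Matrix.mulVec (Y : Matrix (Fin 2) (Fin 2) ℂ) v ≠ c • v :=
    fun c hc => hXY v hv ⟨l, hXv⟩ ⟨c, hc⟩
  have hdX := X.det_coe
  have hdY := Y.det_coe
  rw [Matrix.SpecialLinearGroup.coe_mul]
  generalize (X : Matrix (Fin 2) (Fin 2) ℂ) = A at *
  generalize (Y : Matrix (Fin 2) (Fin 2) ℂ) = B at *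
  set w := B.mulVec v with hw
  have hd : v 0 * w 1 - w 0 * v 1 ≠ 0 := by
    intro hd
    have hne : !![v 1, -v 0; 0, 0] ≠ 0 := by
      intro h
      apply hv
      have h0 := congrFun (congrFun h 0) 1
      have h1 := congrFun (congrFun h 0) 0
      simp at h0 h1
      ext i; fin_cases i <;> simp [h0, h1]
    obtain ⟨c, hc⟩ := exists_smul_of_mulVec_eq_zero (v := v) (w := w) hne hv
      (by ext i; fin_cases i <;> simp [Matrix.mulVec, dotProduct, Fin.sum_univ_two]; ring)
      (by
        ext i; fin_cases i <;> simp [Matrix.mulVec, dotProduct, Fin.sum_univ_two]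
        linear_combination -hd)
    exact hYv c hc
  obtain ⟨s, hs⟩ := IsAlgClosed.exists_pow_nat_eq (v 0 * w 1 - w 0 * v 1)⁻¹ (n := 2) (by norm_num)
  have hdetP : Matrix.det !![s * v 0, s * w 0; s * v 1, s * w 1] = 1 := by
    rw [Matrix.det_fin_two_of]
    have := mul_inv_cancel₀ hd
    rw [← hs] at this
    linear_combination this
  refine ⟨⟨_, hdetP⟩, ?_, ?_⟩
  · have h0 := congrFun hXv 0
    have h1 := congrFun hXv 1
    have hw0 := congrFun hw 0
    have hw1 := congrFun hw 1
    simp only [Matrix.mulVec, dotProduct, Fin.sum_univ_two, Pi.smul_apply, smul_eq_mul]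
      at h0 h1 hw0 hw1
    ext i j
    fin_cases i <;> fin_cases j <;>
      simp [Matrix.mul_apply, Fin.sum_univ_two, Matrix.trace_fin_two, hw0, hw1]
    · linear_combination s * h0
    · linear_combination s * (B 1 1 * h0 - B 0 1 * h1)
    · linear_combination s * h1
    · linear_combination s * (B 0 0 * h1 - B 1 0 * h0)
  · have hw0 := congrFun hw 0
    have hw1 := congrFun hw 1
    simp only [Matrix.mulVec, dotProduct, Fin.sum_univ_two] at hw0 hw1
    rw [Matrix.det_fin_two] at hdY
    ext i j
    fin_cases i <;> fin_cases j <;>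
      simp [Matrix.mul_apply, Fin.sum_univ_two, Matrix.trace_fin_two, hw0, hw1]
    · ring
    · linear_combination -s * v 0 * hdY
    · ring
    · linear_combination -s * v 1 * hdY

/-- Pairs of elements of `SL₂(ℂ)` without a common eigenvector are determined up to
conjugation by their traces and the trace of the product. -/
theorem exists_conj_of_trace_eq {X Y X' Y' : SL2C}
    (hXY : ∀ v : Fin 2 → ℂ, v ≠ 0 → X ∈ lineStabilizer v → Y ∉ lineStabilizer v)
    (hXY' : ∀ v : Fin 2 → ℂ, v ≠ 0 → X' ∈ lineStabilizer v → Y' ∉ lineStabilizer v)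
    (hX : Matrix.trace (X : Matrix (Fin 2) (Fin 2) ℂ) =
      Matrix.trace (X' : Matrix (Fin 2) (Fin 2) ℂ))
    (hY : Matrix.trace (Y : Matrix (Fin 2) (Fin 2) ℂ) =
      Matrix.trace (Y' : Matrix (Fin 2) (Fin 2) ℂ))
    (hmul : Matrix.trace ((X * Y : SL2C) : Matrix (Fin 2) (Fin 2) ℂ) =
      Matrix.trace ((X' * Y' : SL2C) : Matrix (Fin 2) (Fin 2) ℂ)) :
    ∃ P : SL2C, X' = P * X * P⁻¹ ∧ Y' = P * Y * P⁻¹ := by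
  obtain ⟨l, hl⟩ := exists_root (Matrix.trace (X : Matrix (Fin 2) (Fin 2) ℂ))
  obtain ⟨P, hPX, hPY⟩ := exists_normal_form hXY hl
  rw [hX] at hl
  obtain ⟨Q, hQX, hQY⟩ := exists_normal_form hXY' hl
  rw [← hX, ← hY, ← hmul] at hQX
  rw [← hY] at hQY
  have key : ∀ (M M' : SL2C) (N : Matrix (Fin 2) (Fin 2) ℂ),
      (M : Matrix (Fin 2) (Fin 2) ℂ) * P = P * N → (M' : Matrix (Fin 2) (Fin 2) ℂ) * Q = Q * N →
      M' = (Q * P⁻¹) * M * (Q * P⁻¹)⁻¹ := by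
    intro M M' N hM hM'
    have hP : ((P⁻¹ : SL2C) : Matrix (Fin 2) (Fin 2) ℂ) * P = 1 := by
      rw [← Matrix.SpecialLinearGroup.coe_mul]; simp
    have hN : N = ((P⁻¹ * M * P : SL2C) : Matrix (Fin 2) (Fin 2) ℂ) := by
      rw [Matrix.SpecialLinearGroup.coe_mul, Matrix.SpecialLinearGroup.coe_mul, mul_assoc, hM,
        ← mul_assoc, hP, one_mul]
    rw [hN, ← Matrix.SpecialLinearGroup.coe_mul, ← Matrix.SpecialLinearGroup.coe_mul] at hM'
    have h : M' * Q = Q * (P⁻¹ * M * P) := Subtype.coe_injective hM'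
    rw [eq_mul_inv_of_mul_eq h]
    group
  exact ⟨Q * P⁻¹, key X X' _ hPX hQX, key Y Y' _ hPY hQY⟩

theorem exists_pair_of_traces (t₁ t₂ t₃ : ℂ) : ∃ X Y : SL2C,
    Matrix.trace (X : Matrix (Fin 2) (Fin 2) ℂ) = t₁ ∧
    Matrix.trace (Y : Matrix (Fin 2) (Fin 2) ℂ) = t₂ ∧
    Matrix.trace ((X * Y : SL2C) : Matrix (Fin 2) (Fin 2) ℂ) = t₃ := by
  obtain ⟨l, hl⟩ := exists_root t₁
  have hX : Matrix.det !![l, t₃ - (t₁ - l) * t₂; 0, t₁ - l] = 1 := by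
    rw [Matrix.det_fin_two_of]
    linear_combination -hl
  have hY : Matrix.det !![0, -1; 1, t₂] = 1 := by
    rw [Matrix.det_fin_two_of]
    ring
  refine ⟨(⟨_, hX⟩ : SL2C), (⟨_, hY⟩ : SL2C), ?_, ?_, ?_⟩
  · simp [Matrix.trace_fin_two]
  · simp [Matrix.trace_fin_two]
  · change Matrix.trace (!![l, t₃ - (t₁ - l) * t₂; 0, t₁ - l] * !![0, -1; 1, t₂]) = t₃
    simp [Matrix.trace_fin_two]

theorem sin_smul_pow (X : SL2C) (θ : ℂ)
    (hθ : Matrix.trace (X : Matrix (Fin 2) (Fin 2) ℂ) = 2 * Complex.cos θ) (n : ℕ) :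
    Complex.sin θ • (X : Matrix (Fin 2) (Fin 2) ℂ) ^ n =
      Complex.sin (n * θ) • (X : Matrix (Fin 2) (Fin 2) ℂ) - Complex.sin ((n - 1) * θ) • 1 := by
  induction n with
  | zero => simp
  | succ n ih =>
    rw [pow_succ, ← smul_mul_assoc, ih, sub_mul, smul_mul_assoc, sl2_mul_self, hθ, smul_mul_assoc,
      one_mul]
    have h1 : Complex.sin (((n + 1 : ℕ) : ℂ) * θ) =
        2 * Complex.cos θ * Complex.sin (n * θ) - Complex.sin ((n - 1) * θ) := by
      rw [show ((n + 1 : ℕ) : ℂ) * θ = n * θ + θ by push_cast; ring,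
        show ((n : ℂ) - 1) * θ = n * θ - θ by ring, Complex.sin_add, Complex.sin_sub]
      ring
    rw [h1, show (((n + 1 : ℕ) : ℂ) - 1) = n by push_cast; ring]
    module

theorem pow_of_trace_eq_two_mul (X : SL2C) (σ : ℂ) (hσ : σ ^ 2 = 1)
    (h : Matrix.trace (X : Matrix (Fin 2) (Fin 2) ℂ) = 2 * σ) (n : ℕ) :
    (X : Matrix (Fin 2) (Fin 2) ℂ) ^ (n + 1) =
      σ ^ n • (((n : ℂ) + 1) • (X : Matrix (Fin 2) (Fin 2) ℂ) - (n * σ) • 1) := by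
  induction n with
  | zero => simp
  | succ n ih =>
    rw [pow_succ, ih, smul_mul_assoc, sub_mul, smul_mul_assoc, sl2_mul_self, h, smul_mul_assoc,
      one_mul]
    push_cast
    linear_combination (norm := module) (σ ^ n * (n + 1)) • hσ • (1 : Matrix (Fin 2) (Fin 2) ℂ)

theorem sl2_neg_one_ne_one : (-1 : SL2C) ≠ 1 := by
  intro h
  have := congrArg (fun M : SL2C => (M : Matrix (Fin 2) (Fin 2) ℂ) 0 0) h
  norm_num at this

theorem sin_mul_pi_div_ne_zero {p k : ℕ} (hk : k ∈ Finset.Ioo 0 p) :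
    Complex.sin (k * Real.pi / p) ≠ 0 := by
  rw [Finset.mem_Ioo] at hk
  have hp : (0 : ℝ) < p := by exact_mod_cast hk.1.trans hk.2
  have h : Real.sin (k * Real.pi / p) ≠ 0 := by
    apply ne_of_gt
    apply Real.sin_pos_of_pos_of_lt_pi
    · have : (0 : ℝ) < k := by exact_mod_cast hk.1
      positivity
    · rw [div_lt_iff₀ hp, mul_comm]
      exact mul_lt_mul_of_pos_left (by exact_mod_cast hk.2) Real.pi_pos
  exact_mod_cast h

theorem coe_neg_one_pow (k : ℕ) :
    (((-1 : SL2C) ^ k : SL2C) : Matrix (Fin 2) (Fin 2) ℂ) = (-1 : ℂ) ^ k • 1 := by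
  rcases Nat.even_or_odd k with h | h
  · simp [h.neg_one_pow]
  · simp [h.neg_one_pow]

theorem pow_eq_neg_one_pow {X : SL2C} {p k : ℕ} (hk : k ∈ Finset.Ioo 0 p)
    (hX : Matrix.trace (X : Matrix (Fin 2) (Fin 2) ℂ) = 2 * Complex.cos (k * Real.pi / p)) :
    X ^ p = (-1) ^ k := by
  have hs := sin_mul_pi_div_ne_zero hk
  have hp : (p : ℂ) ≠ 0 := by
    rw [Finset.mem_Ioo] at hk
    exact_mod_cast (hk.1.trans hk.2).ne'
  have h := sin_smul_pow X _ hX p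
  have h1 : (p : ℂ) * (k * Real.pi / p) = k * Real.pi := by field_simp
  have h2 : Complex.cos (k * Real.pi) = (-1) ^ k := by exact_mod_cast Real.cos_nat_mul_pi k
  rw [sub_mul, h1, one_mul, Complex.sin_sub, Complex.sin_nat_mul_pi, h2,
    zero_smul, zero_mul, zero_sub, zero_sub, neg_smul, neg_neg,
    mul_comm ((-1 : ℂ) ^ k), mul_smul] at h
  apply Subtype.coe_injective
  change ((X ^ p : SL2C) : Matrix (Fin 2) (Fin 2) ℂ) =
    (((-1 : SL2C) ^ k : SL2C) : Matrix (Fin 2) (Fin 2) ℂ)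
  rw [Matrix.SpecialLinearGroup.coe_pow, coe_neg_one_pow]
  apply smul_right_injective _ hs
  exact h

theorem exists_cos_eq_of_int {p : ℕ} (hp : 0 < p) (j : ℤ) :
    ∃ k : ℕ, k ≤ p ∧ Complex.cos (j * Real.pi / p) = Complex.cos (k * Real.pi / p) := by
  have hp' : (p : ℂ) ≠ 0 := by exact_mod_cast hp.ne'
  have h0 : 0 ≤ j % (2 * p) := Int.emod_nonneg _ (by omega)
  have h1 : j % (2 * p) < 2 * p := Int.emod_lt_of_pos _ (by omega)
  have hj := Int.emod_add_mul_ediv j (2 * p)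
  generalize j / (2 * p) = d at *
  obtain ⟨m, hm⟩ := Int.eq_ofNat_of_zero_le h0
  rw [hm] at h1 hj
  have hc : Complex.cos (j * Real.pi / p) = Complex.cos (m * Real.pi / p) := by
    rw [← hj, ← Complex.cos_add_int_mul_two_pi (m * Real.pi / p) d]
    congr 1
    push_cast
    field_simp
  by_cases hmp : m ≤ p
  · exact ⟨m, hmp, hc⟩
  · refine ⟨2 * p - m, by omega, ?_⟩
    rw [hc, ← Complex.cos_two_pi_sub]
    congr 1
    rw [Nat.cast_sub (by omega)]
    push_cast
    field_simp

theorem exists_trace_eq_two_mul_cos {X : SL2C} {p : ℕ} (hp : 0 < p)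
    (hX : ∀ c : ℂ, (X : Matrix (Fin 2) (Fin 2) ℂ) ≠ c • 1) {s : ℂ}
    (hpow : (X : Matrix (Fin 2) (Fin 2) ℂ) ^ p = s • 1) :
    ∃ k ∈ Finset.Ioo 0 p,
      Matrix.trace (X : Matrix (Fin 2) (Fin 2) ℂ) = 2 * Complex.cos (k * Real.pi / p) := by
  have hscalar : ∀ u v : ℂ, u • (X : Matrix (Fin 2) (Fin 2) ℂ) = v • 1 → u = 0 := by
    intro u v h
    by_contra hu
    apply hX (u⁻¹ * v)
    rw [mul_smul, ← h, inv_smul_smul₀ hu]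
  obtain ⟨θ, hθ⟩ := Complex.cos_surjective (Matrix.trace (X : Matrix (Fin 2) (Fin 2) ℂ) / 2)
  replace hθ : Matrix.trace (X : Matrix (Fin 2) (Fin 2) ℂ) = 2 * Complex.cos θ := by
    rw [hθ]; ring
  have hp' : (p : ℂ) ≠ 0 := by exact_mod_cast hp.ne'
  have hsin : Complex.sin θ ≠ 0 := by
    intro h0
    have hσ : Complex.cos θ ^ 2 = 1 := by
      have := Complex.sin_sq_add_cos_sq θ
      rw [h0] at this
      linear_combination this
    obtain ⟨n, rfl⟩ := Nat.exists_eq_add_of_le' hp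
    have h := pow_of_trace_eq_two_mul X _ hσ hθ n
    rw [hpow, smul_sub, smul_smul, smul_smul, eq_sub_iff_add_eq, ← add_smul] at h
    have := hscalar _ _ h.symm
    have hc : Complex.cos θ ≠ 0 := by
      intro hc
      simp [hc] at hσ
    have hn : (n : ℂ) + 1 ≠ 0 := by exact_mod_cast n.succ_ne_zero
    exact mul_ne_zero (pow_ne_zero _ hc) hn this
  have h := sin_smul_pow X θ hθ p
  rw [hpow, smul_smul, eq_sub_iff_add_eq, ← add_smul] at h
  obtain ⟨j, hj⟩ := Complex.sin_eq_zero_iff.mp (hscalar _ _ h.symm)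
  have hθj : θ = j * Real.pi / p := by
    rw [← hj]; field_simp
  obtain ⟨k, hk, hcos⟩ := exists_cos_eq_of_int hp j
  rw [← hθj] at hcos
  refine ⟨k, ?_, by rw [hθ, hcos]⟩
  rw [Ne, Complex.sin_eq_zero_iff_cos_eq, hcos] at hsin
  rw [Finset.mem_Ioo]
  refine ⟨Nat.pos_of_ne_zero ?_, lt_of_le_of_ne hk ?_⟩
  · rintro rfl
    simp at hsin
  · rintro rfl
    apply hsin
    right
    rw [mul_div_assoc, mul_div_cancel₀ _ hp', Complex.cos_pi]

theorem cos_mul_pi_div_injOn (p : ℕ) :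
    Set.InjOn (fun k : ℕ => 2 * Complex.cos (k * Real.pi / p)) (Finset.Ioo 0 p) := by
  intro k hk l hl h
  have hp : (0 : ℝ) < p := by
    rw [Finset.mem_coe, Finset.mem_Ioo] at hk
    exact_mod_cast hk.1.trans hk.2
  have mem : ∀ m ∈ Finset.Ioo 0 p, (m * Real.pi / p : ℝ) ∈ Set.Icc 0 Real.pi := by
    intro m hm
    rw [Finset.mem_Ioo] at hm
    refine ⟨by positivity, ?_⟩
    rw [div_le_iff₀ hp, mul_comm]
    exact mul_le_mul_of_nonneg_left (by exact_mod_cast hm.2.le) Real.pi_pos.le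
  have h' : Real.cos (k * Real.pi / p) = Real.cos (l * Real.pi / p) := by
    have := mul_left_cancel₀ two_ne_zero h
    exact_mod_cast this
  have := Real.injOn_cos (mem k hk) (mem l hl) h'
  have hpi := Real.pi_ne_zero
  field_simp at this
  exact_mod_cast this

theorem neg_one_zpow_eq_pow_iff (n : ℤ) (m : ℕ) :
    (-1 : SL2C) ^ m = (-1 : SL2C) ^ n ↔ Even (m - n : ℤ) := by
  rw [Int.even_sub]
  have hz : ∀ n : ℤ, Odd n → (-1 : SL2C) ^ n = -1 := by
    rintro n ⟨d, rfl⟩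
    rw [zpow_add, zpow_mul]
    simp
  have he : ∀ n : ℤ, Even n → (-1 : SL2C) ^ n = 1 := by
    rintro n ⟨d, rfl⟩
    rw [← two_mul, zpow_mul]
    simp
  have hne := sl2_neg_one_ne_one
  rw [← zpow_natCast]
  rcases Int.even_or_odd (m : ℤ) with hm | hm <;> rcases Int.even_or_odd n with hn | hn
  · simp [he _ hm, he _ hn, hm, hn]
  · simp [he _ hm, hz _ hn, hm, Int.not_even_iff_odd.mpr hn, hne.symm]
  · simp [hz _ hm, he _ hn, hn, Int.not_even_iff_odd.mpr hm, hne]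
  · simp [hz _ hm, hz _ hn, Int.not_even_iff_odd.mpr hm, Int.not_even_iff_odd.mpr hn]

theorem eigenvalue_sq_pow_eq_one {X : SL2C} {p k : ℕ} (hX : X ^ p = (-1) ^ k) {v : Fin 2 → ℂ}
    (hv : v ≠ 0) {c : ℂ} (hc : Matrix.mulVec (X : Matrix (Fin 2) (Fin 2) ℂ) v = c • v) :
    (c ^ 2) ^ p = 1 := by
  have hpow : ∀ n : ℕ, Matrix.mulVec ((X : Matrix (Fin 2) (Fin 2) ℂ) ^ n) v = c ^ n • v := by
    intro n
    induction n with
    | zero => simp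
    | succ n ih => rw [pow_succ, ← Matrix.mulVec_mulVec, hc, Matrix.mulVec_smul, ih, smul_smul,
        mul_comm, pow_succ]
  have h := hpow p
  rw [← Matrix.SpecialLinearGroup.coe_pow, hX, coe_neg_one_pow, Matrix.smul_mulVec,
    Matrix.one_mulVec] at h
  have := smul_left_injective ℂ hv h
  rw [pow_right_comm, ← this, pow_right_comm, neg_one_sq, one_pow]

theorem trace_of_eigenvalue {X : SL2C} {v : Fin 2 → ℂ} (hv : v ≠ 0) {c : ℂ}
    (hc : Matrix.mulVec (X : Matrix (Fin 2) (Fin 2) ℂ) v = c • v) :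
    c ^ 2 - Matrix.trace (X : Matrix (Fin 2) (Fin 2) ℂ) * c + 1 = 0 := by
  have h : Matrix.mulVec ((X : Matrix (Fin 2) (Fin 2) ℂ) * (X : Matrix (Fin 2) (Fin 2) ℂ)) v =
      (c * c) • v := by
    rw [← Matrix.mulVec_mulVec, hc, Matrix.mulVec_smul, hc, smul_smul]
  rw [sl2_mul_self, Matrix.sub_mulVec, Matrix.smul_mulVec, hc, Matrix.one_mulVec, smul_smul] at h
  have h' : (c ^ 2 - Matrix.trace (X : Matrix (Fin 2) (Fin 2) ℂ) * c + 1) • v = 0 := by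
    rw [pow_two, add_smul, sub_smul, ← h]
    module
  exact (smul_eq_zero.mp h').resolve_right hv

/-- Elements whose orders modulo `±1` are pairwise coprime, as is that of the product, have no
common eigenvector. -/
theorem no_common_eigenvector {X Y : SL2C} {p q r k l m : ℕ} (hpq : Nat.Coprime p q)
    (hpr : Nat.Coprime p r) (hk : k ∈ Finset.Ioo 0 p)
    (htr : Matrix.trace (X : Matrix (Fin 2) (Fin 2) ℂ) = 2 * Complex.cos (k * Real.pi / p))
    (hY : Y ^ q = (-1) ^ l) (hXY : (X * Y) ^ r = (-1) ^ m)
    {v : Fin 2 → ℂ} (hv : v ≠ 0) (hXv : X ∈ lineStabilizer v) : Y ∉ lineStabilizer v := by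
  rintro ⟨d, hd⟩
  obtain ⟨c, hc⟩ := hXv
  have hcd : Matrix.mulVec ((X * Y : SL2C) : Matrix (Fin 2) (Fin 2) ℂ) v = (c * d) • v := by
    rw [Matrix.SpecialLinearGroup.coe_mul, ← Matrix.mulVec_mulVec, hd, Matrix.mulVec_smul, hc,
      smul_smul, mul_comm]
  have h1 := eigenvalue_sq_pow_eq_one (pow_eq_neg_one_pow hk htr) hv hc
  have h2 := eigenvalue_sq_pow_eq_one hY hv hd
  have h3 := eigenvalue_sq_pow_eq_one hXY hv hcd
  have h4 : (c ^ 2) ^ (q * r) = 1 := by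
    have : ((c * d) ^ 2) ^ (q * r) = 1 := by rw [mul_comm q, pow_mul, h3, one_pow]
    rw [mul_pow, mul_pow, pow_mul (d ^ 2), h2, one_pow, mul_one] at this
    exact this
  have h5 : c ^ 2 = 1 := by
    rw [← pow_one (c ^ 2), ← (Nat.Coprime.mul_right hpq hpr : Nat.gcd p (q * r) = 1)]
    exact pow_gcd_eq_one.mpr ⟨h1, h4⟩
  have h6 := trace_of_eigenvalue hv hc
  rw [htr, h5] at h6
  apply sin_mul_pi_div_ne_zero hk
  rw [← sq_eq_zero_iff, Complex.sin_sq]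
  have h7 : Complex.cos (k * Real.pi / p) * c = 1 := by linear_combination -h6 / 2
  linear_combination (-1) * (Complex.cos (k * Real.pi / p) * c + 1) * h7 +
    Complex.cos (k * Real.pi / p) ^ 2 * h5

section Brieskorn

variable {p q r : ℕ} {a b c : ℤ}

theorem forall_brieskornRels_lift_eq_one_iff (f : Fin 4 → SL2C) :
    (∀ w ∈ brieskornRels p q r a b c, FreeGroup.lift f w = 1) ↔
      f 3 * f 0 * (f 3)⁻¹ * (f 0)⁻¹ = 1 ∧ f 3 * f 1 * (f 3)⁻¹ * (f 1)⁻¹ = 1 ∧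
      f 3 * f 2 * (f 3)⁻¹ * (f 2)⁻¹ = 1 ∧ f 0 ^ p * (f 3 ^ a)⁻¹ = 1 ∧
      f 1 ^ q * (f 3 ^ b)⁻¹ = 1 ∧ f 2 ^ r * (f 3 ^ c)⁻¹ = 1 ∧ f 0 * f 1 * f 2 = 1 := by
  simp only [brieskornRels, Set.mem_insert_iff, Set.mem_singleton_iff, forall_eq_or_imp, forall_eq,
    map_mul, map_inv, map_pow, map_zpow, FreeGroup.lift_apply_of]

theorem brieskorn_relations (ρ : PresentedGroup (brieskornRels p q r a b c) →* SL2C) :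
    Commute (ρ (.of 3)) (ρ (.of 0)) ∧ Commute (ρ (.of 3)) (ρ (.of 1)) ∧
    ρ (.of 0) ^ p = ρ (.of 3) ^ a ∧ ρ (.of 1) ^ q = ρ (.of 3) ^ b ∧
    ρ (.of 2) ^ r = ρ (.of 3) ^ c ∧ ρ (.of 2) = (ρ (.of 0) * ρ (.of 1))⁻¹ := by
  have hlift : FreeGroup.lift (fun i => ρ (.of i)) = ρ.comp (PresentedGroup.mk _) := by
    ext1 i
    rw [FreeGroup.lift_apply_of]
    rfl
  have key : ∀ w ∈ brieskornRels p q r a b c, FreeGroup.lift (fun i => ρ (.of i)) w = 1 := by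
    intro w hw
    rw [hlift, MonoidHom.comp_apply, PresentedGroup.one_of_mem hw, map_one]
  obtain ⟨h1, h2, -, h4, h5, h6, h7⟩ := (forall_brieskornRels_lift_eq_one_iff _).mp key
  exact ⟨eq_of_mul_inv_eq_one (by rwa [mul_inv_rev, ← mul_assoc]),
    eq_of_mul_inv_eq_one (by rwa [mul_inv_rev, ← mul_assoc]),
    mul_inv_eq_one.mp h4, mul_inv_eq_one.mp h5, mul_inv_eq_one.mp h6,
    eq_inv_of_mul_eq_one_right h7⟩

theorem exists_brieskorn_rep {X Y : SL2C} {e : ℕ} (hX : X ^ p = ((-1) ^ e) ^ a)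
    (hY : Y ^ q = ((-1) ^ e) ^ b) (hZ : ((X * Y)⁻¹) ^ r = ((-1) ^ e) ^ c) :
    ∃ ρ : PresentedGroup (brieskornRels p q r a b c) →* SL2C,
      ρ (.of 0) = X ∧ ρ (.of 1) = Y ∧ ρ (.of 2) = (X * Y)⁻¹ ∧ ρ (.of 3) = (-1) ^ e := by
  have hcomm : ∀ M : SL2C, (-1) ^ e * M = M * (-1) ^ e := by
    intro M
    rcases neg_one_pow_eq_or SL2C e with h | h <;> simp [h]
  have hf : ∀ w ∈ brieskornRels p q r a b c,
      FreeGroup.lift ![X, Y, (X * Y)⁻¹, (-1) ^ e] w = 1 := by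
    rw [forall_brieskornRels_lift_eq_one_iff]
    refine ⟨?_, ?_, ?_, ?_, ?_, ?_, ?_⟩
    · simp [hcomm]
    · simp [hcomm]
    · simp [hcomm]
    · simp [hX]
    · simp [hY]
    · simpa [mul_inv_eq_one] using hZ
    · simp
  exact ⟨PresentedGroup.toGroup hf, PresentedGroup.toGroup.of hf, PresentedGroup.toGroup.of hf,
    PresentedGroup.toGroup.of hf, PresentedGroup.toGroup.of hf⟩

theorem isIrreducibleRep_iff (ρ : PresentedGroup (brieskornRels p q r a b c) →* SL2C) :
    IsIrreducibleRep ρ ↔ ∀ v : Fin 2 → ℂ, v ≠ 0 → ρ (.of 3) ∈ lineStabilizer v →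
      ρ (.of 0) ∈ lineStabilizer v → ρ (.of 1) ∉ lineStabilizer v := by
  constructor
  · intro h v hv h3 h0 h1
    refine h ⟨v, hv, fun g => ?_⟩
    have h2 : ρ (.of 2) ∈ lineStabilizer v := by
      rw [(brieskorn_relations ρ).2.2.2.2.2]
      exact inv_mem (mul_mem h0 h1)
    refine PresentedGroup.generated_by _ ((lineStabilizer v).comap ρ) ?_ g
    intro i
    fin_cases i <;> assumption
  · rintro h ⟨v, hv, hg⟩
    exact h v hv (hg _) (hg _) (hg _)

theorem brieskorn_generators_of_irreducible
    {ρ : PresentedGroup (brieskornRels p q r a b c) →* SL2C} (hρ : IsIrreducibleRep ρ) :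
    (ρ (.of 3) = 1 ∨ ρ (.of 3) = -1) ∧
    (∀ v : Fin 2 → ℂ, v ≠ 0 → ρ (.of 0) ∈ lineStabilizer v → ρ (.of 1) ∉ lineStabilizer v) ∧
    (∀ s : ℂ, (ρ (.of 0) : Matrix (Fin 2) (Fin 2) ℂ) ≠ s • 1) ∧
    (∀ s : ℂ, (ρ (.of 1) : Matrix (Fin 2) (Fin 2) ℂ) ≠ s • 1) ∧
    ∀ s : ℂ, (ρ (.of 2) : Matrix (Fin 2) (Fin 2) ℂ) ≠ s • 1 := by
  rw [isIrreducibleRep_iff] at hρ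
  obtain ⟨hc0, hc1, -, -, -, hz⟩ := brieskorn_relations ρ
  have h3 : ∃ s : ℂ, (ρ (.of 3) : Matrix (Fin 2) (Fin 2) ℂ) = s • 1 := by
    by_contra! hns
    obtain ⟨v, hv, h⟩ := exists_mem_lineStabilizer (ρ (.of 3))
    exact hρ v hv h (mem_lineStabilizer_of_commute hc0 hns hv h)
      (mem_lineStabilizer_of_commute hc1 hns hv h)
  obtain ⟨s, hs⟩ := h3
  have hirr : ∀ v : Fin 2 → ℂ, v ≠ 0 → ρ (.of 0) ∈ lineStabilizer v →
      ρ (.of 1) ∉ lineStabilizer v :=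
    fun v hv => hρ v hv (mem_lineStabilizer_of_coe_eq_smul_one hs v)
  refine ⟨eq_one_or_neg_one_of_coe_eq_smul_one hs, hirr, ?_, ?_, ?_⟩
  · intro t ht
    obtain ⟨v, hv, h⟩ := exists_mem_lineStabilizer (ρ (.of 1))
    exact hirr v hv (mem_lineStabilizer_of_coe_eq_smul_one ht v) h
  · intro t ht
    obtain ⟨v, hv, h⟩ := exists_mem_lineStabilizer (ρ (.of 0))
    exact hirr v hv h (mem_lineStabilizer_of_coe_eq_smul_one ht v)
  · intro t ht
    obtain ⟨v, hv, h⟩ := exists_mem_lineStabilizer (ρ (.of 0))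
    refine hirr v hv h ?_
    have h2 := mem_lineStabilizer_of_coe_eq_smul_one ht v
    have : ρ (.of 1) = (ρ (.of 0))⁻¹ * (ρ (.of 2))⁻¹ := by rw [hz]; group
    rw [this]
    exact mul_mem (inv_mem h) (inv_mem h2)

/-- The traces of the images of the four generators. -/
def generatorTraces (ρ : PresentedGroup (brieskornRels p q r a b c) →* SL2C) : Fin 4 → ℂ :=
  fun i => Matrix.trace (ρ (.of i) : Matrix (Fin 2) (Fin 2) ℂ)

theorem conjRel_iff_generatorTraces_eq
    (ρ₁ ρ₂ : {ρ : PresentedGroup (brieskornRels p q r a b c) →* SL2C // IsIrreducibleRep ρ}) :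
    ConjRel ρ₁ ρ₂ ↔ generatorTraces ρ₁.1 = generatorTraces ρ₂.1 := by
  constructor
  · rintro ⟨P, hP⟩
    ext i
    rw [generatorTraces, generatorTraces, hP, Matrix.SpecialLinearGroup.coe_mul,
      Matrix.SpecialLinearGroup.coe_mul, Matrix.trace_mul_comm, ← mul_assoc,
      ← Matrix.SpecialLinearGroup.coe_mul]
    simp
  · intro h
    obtain ⟨h3, hirr, -⟩ := brieskorn_generators_of_irreducible ρ₁.2
    obtain ⟨h3', hirr', -⟩ := brieskorn_generators_of_irreducible ρ₂.2
    have hz := (brieskorn_relations ρ₁.1).2.2.2.2.2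
    have hz' := (brieskorn_relations ρ₂.1).2.2.2.2.2
    have hi : ∀ i, Matrix.trace (ρ₁.1 (.of i) : Matrix (Fin 2) (Fin 2) ℂ) =
      Matrix.trace (ρ₂.1 (.of i) : Matrix (Fin 2) (Fin 2) ℂ) := congrFun h
    obtain ⟨P, hX, hY⟩ := exists_conj_of_trace_eq hirr hirr' (hi 0) (hi 1) (by
      rw [← sl2_inv_trace, ← hz, hi 2, hz', sl2_inv_trace])
    have h33 : ρ₂.1 (.of 3) = P * ρ₁.1 (.of 3) * P⁻¹ := by
      have := hi 3
      rcases h3 with h3 | h3 <;> rcases h3' with h3' | h3' <;> rw [h3, h3'] at this ⊢ <;>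
        first | (simp; done) | (exfalso; norm_num [Matrix.trace_fin_two] at this)
    have hext : ρ₂.1 = (MulAut.conj P).toMonoidHom.comp ρ₁.1 := by
      apply PresentedGroup.ext
      intro i
      change ρ₂.1 (.of i) = P * ρ₁.1 (.of i) * P⁻¹
      fin_cases i
      · exact hX
      · exact hY
      · change ρ₂.1 (.of 2) = P * ρ₁.1 (.of 2) * P⁻¹
        rw [hz', hz, hX, hY]
        group
      · exact h33
    exact ⟨P, fun g => DFunLike.congr_fun hext g⟩

variable (p) in
/-- The `k` with `0 < k < p` and `k ≡ s mod 2`. -/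
def angleIndices (s : ℤ) : Finset ℕ :=
  {k ∈ Finset.Ioo 0 p | Even (k - s : ℤ)}

variable (p q r a b c) in
/-- The indices `(e, k, l, m)` of representations sending the central generator to `(-1) ^ e`. -/
def repIndices : Finset (Σ _ : ℕ, ℕ × ℕ × ℕ) :=
  (Finset.range 2).sigma fun e =>
    angleIndices p (e * a) ×ˢ angleIndices q (e * b) ×ˢ angleIndices r (e * c)

variable (p q r) in
/-- The traces of the generators for the representation with a given index. -/
noncomputable def indexTraces (x : Σ _ : ℕ, ℕ × ℕ × ℕ) : Fin 4 → ℂ :=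
  ![2 * Complex.cos (x.2.1 * Real.pi / p), 2 * Complex.cos (x.2.2.1 * Real.pi / q),
    2 * Complex.cos (x.2.2.2 * Real.pi / r), 2 * (-1) ^ x.1]

theorem mem_repIndices {e k l m : ℕ} : ⟨e, k, l, m⟩ ∈ repIndices p q r a b c ↔
    e < 2 ∧ k ∈ angleIndices p (e * a) ∧ l ∈ angleIndices q (e * b) ∧
      m ∈ angleIndices r (e * c) := by
  simp [repIndices]

theorem indexTraces_injOn : Set.InjOn (indexTraces p q r) (repIndices p q r a b c) := by
  rintro ⟨e, k, l, m⟩ hx ⟨e', k', l', m'⟩ hx' h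
  rw [Finset.mem_coe, mem_repIndices] at hx hx'
  obtain ⟨he, hk, hl, hm⟩ := hx
  obtain ⟨he', hk', hl', hm'⟩ := hx'
  obtain rfl := cos_mul_pi_div_injOn p (Finset.mem_of_mem_filter _ hk)
    (Finset.mem_of_mem_filter _ hk') (congrFun h 0)
  obtain rfl := cos_mul_pi_div_injOn q (Finset.mem_of_mem_filter _ hl)
    (Finset.mem_of_mem_filter _ hl') (congrFun h 1)
  obtain rfl := cos_mul_pi_div_injOn r (Finset.mem_of_mem_filter _ hm)
    (Finset.mem_of_mem_filter _ hm') (congrFun h 2)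
  have h3 : (2 : ℂ) * (-1) ^ e = 2 * (-1) ^ e' := congrFun h 3
  have : e = e' := by
    interval_cases e <;> interval_cases e' <;> first | rfl | (exfalso; norm_num at h3)
  rw [this]

theorem trace_neg_one_pow (e : ℕ) :
    Matrix.trace (((-1 : SL2C) ^ e : SL2C) : Matrix (Fin 2) (Fin 2) ℂ) = 2 * (-1) ^ e := by
  rw [coe_neg_one_pow, Matrix.trace_smul, Matrix.trace_one]
  simp [mul_comm]

theorem exists_index_of_irreducible (hp : 0 < p) (hq : 0 < q) (hr : 0 < r)
    {ρ : PresentedGroup (brieskornRels p q r a b c) →* SL2C} (hρ : IsIrreducibleRep ρ) :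
    ∃ x ∈ repIndices p q r a b c, indexTraces p q r x = generatorTraces ρ := by
  obtain ⟨h3, -, hX, hY, hZ⟩ := brieskorn_generators_of_irreducible hρ
  obtain ⟨-, -, hpowX, hpowY, hpowZ, -⟩ := brieskorn_relations ρ
  obtain ⟨e, he, h3⟩ : ∃ e : ℕ, e < 2 ∧ ρ (.of 3) = (-1) ^ e := by
    rcases h3 with h3 | h3
    · exact ⟨0, by norm_num, by simp [h3]⟩
    · exact ⟨1, by norm_num, by simp [h3]⟩
  rw [h3, ← zpow_natCast (-1) e, ← zpow_mul] at hpowX hpowY hpowZ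
  have key : ∀ {M : SL2C} {n : ℕ} {d : ℤ}, 0 < n →
      (∀ s : ℂ, (M : Matrix (Fin 2) (Fin 2) ℂ) ≠ s • 1) → M ^ n = (-1) ^ d →
      ∃ k ∈ angleIndices n d,
        Matrix.trace (M : Matrix (Fin 2) (Fin 2) ℂ) = 2 * Complex.cos (k * Real.pi / n) := by
    intro M n d hn hM hpow
    have hs : ∃ s : ℂ, (M : Matrix (Fin 2) (Fin 2) ℂ) ^ n = s • 1 := by
      rw [← Matrix.SpecialLinearGroup.coe_pow, hpow]
      rcases Int.even_or_odd d with hd | hd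
      · exact ⟨(-1) ^ 0, by
          rw [← coe_neg_one_pow, (neg_one_zpow_eq_pow_iff d 0).mpr (by simpa using hd)]⟩
      · exact ⟨(-1) ^ 1, by
          rw [← coe_neg_one_pow, (neg_one_zpow_eq_pow_iff d 1).mpr (by
            simpa [Int.even_sub] using hd)]⟩
    obtain ⟨s, hs⟩ := hs
    obtain ⟨k, hk, ht⟩ := exists_trace_eq_two_mul_cos hn hM hs
    refine ⟨k, Finset.mem_filter.mpr ⟨hk, ?_⟩, ht⟩
    rw [← neg_one_zpow_eq_pow_iff, ← hpow, pow_eq_neg_one_pow hk ht]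
  obtain ⟨k, hk, hk'⟩ := key hp hX hpowX
  obtain ⟨l, hl, hl'⟩ := key hq hY hpowY
  obtain ⟨m, hm, hm'⟩ := key hr hZ hpowZ
  refine ⟨⟨e, k, l, m⟩, mem_repIndices.mpr ⟨he, hk, hl, hm⟩, ?_⟩
  ext i
  fin_cases i
  · exact hk'.symm
  · exact hl'.symm
  · exact hm'.symm
  · simp only [generatorTraces, Fin.reduceFinMk, h3, trace_neg_one_pow]
    rfl

theorem exists_irreducible_of_index (hpq : Nat.Coprime p q) (hpr : Nat.Coprime p r)
    {x : Σ _ : ℕ, ℕ × ℕ × ℕ} (hx : x ∈ repIndices p q r a b c) :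
    ∃ ρ : PresentedGroup (brieskornRels p q r a b c) →* SL2C,
      IsIrreducibleRep ρ ∧ generatorTraces ρ = indexTraces p q r x := by
  obtain ⟨e, k, l, m⟩ := x
  obtain ⟨-, hk, hl, hm⟩ := mem_repIndices.mp hx
  obtain ⟨hk, hk'⟩ := Finset.mem_filter.mp hk
  obtain ⟨hl, hl'⟩ := Finset.mem_filter.mp hl
  obtain ⟨hm, hm'⟩ := Finset.mem_filter.mp hm
  obtain ⟨X, Y, hX, hY, hXY⟩ := exists_pair_of_traces (2 * Complex.cos (k * Real.pi / p))
    (2 * Complex.cos (l * Real.pi / q)) (2 * Complex.cos (m * Real.pi / r))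
  have hZ := hXY
  rw [← sl2_inv_trace] at hZ
  rw [← neg_one_zpow_eq_pow_iff, zpow_mul, zpow_natCast] at hk' hl' hm'
  obtain ⟨ρ, h0, h1, h2, h3⟩ := exists_brieskorn_rep (p := p) (q := q) (r := r) (e := e)
    ((pow_eq_neg_one_pow hk hX).trans hk') ((pow_eq_neg_one_pow hl hY).trans hl')
    ((pow_eq_neg_one_pow hm hZ).trans hm')
  refine ⟨ρ, ?_, ?_⟩
  · rw [isIrreducibleRep_iff]
    intro v hv _
    rw [h0, h1]
    exact no_common_eigenvector hpq hpr hk hX (pow_eq_neg_one_pow hl hY)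
      (pow_eq_neg_one_pow hm hXY) hv
  · ext i
    fin_cases i
    · simpa [generatorTraces, indexTraces, h0] using hX
    · simpa [generatorTraces, indexTraces, h1] using hY
    · simp only [generatorTraces, Fin.reduceFinMk, h2, hZ]
      rfl
    · simp only [generatorTraces, Fin.reduceFinMk, h3, trace_neg_one_pow]
      rfl

theorem card_angleIndices (hp : 0 < p) (s : ℤ) :
    (angleIndices p s).card = if Even s then (p - 1) / 2 else p / 2 := by
  induction p, hp using Nat.le_induction with
  | base =>
    have h : Finset.Ioo 0 1 = (∅ : Finset ℕ) := rfl
    simp [angleIndices, h]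
  | succ n hn ih =>
    have h : Finset.Ioo 0 (n + 1) = insert n (Finset.Ioo 0 n) := by
      ext k
      simp only [Finset.mem_Ioo, Finset.mem_insert]
      lia
    rw [angleIndices] at ih ⊢
    rw [h, Finset.filter_insert]
    have hmem : n ∉ ({k ∈ Finset.Ioo 0 n | Even (k - s : ℤ)} : Finset ℕ) := by simp
    split_ifs with h1 h2 h2
    all_goals
      first | rw [Finset.card_insert_of_notMem hmem, ih] | rw [ih]
      simp only [h2, if_true, if_false]
      simp only [Int.even_iff] at h1 h2
      lia

theorem card_repIndices (hp : 0 < p) (hq : 0 < q) (hr : 0 < r)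
    (habc : a * q * r + b * p * r + c * p * q = 1) :
    (repIndices p q r a b c).card = (p - 1) * (q - 1) * (r - 1) / 4 := by
  have hpar := congrArg (fun n : ℤ => Even n) habc
  simp only [Int.even_add, Int.even_mul, Int.even_coe_nat, Int.not_even_one, eq_iff_iff,
    iff_false] at hpar
  rw [repIndices, Finset.card_sigma, Finset.sum_range_succ, Finset.sum_range_one]
  simp only [Finset.card_product, card_angleIndices hp, card_angleIndices hq, card_angleIndices hr,
    Nat.cast_zero, zero_mul, Nat.cast_one, one_mul, Even.zero, if_true]
  have hcases : ∀ n : ℕ, 0 < n → (∃ m, n = 2 * m + 1 ∧ ¬ Even n ∧ (n - 1) / 2 = m ∧ n / 2 = m) ∨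
      ∃ m, n = 2 * m + 2 ∧ Even n ∧ (n - 1) / 2 = m ∧ n / 2 = m + 1 := by
    intro n hn
    simp only [Nat.even_iff]
    rcases Nat.mod_two_eq_zero_or_one n with h | h
    · exact Or.inr ⟨n / 2 - 1, by lia⟩
    · exact Or.inl ⟨n / 2, by lia⟩
  obtain ⟨P, hp', hp1, hp2, hp3⟩ | ⟨P, hp', hp1, hp2, hp3⟩ := hcases p hp <;>
  obtain ⟨Q, hq', hq1, hq2, hq3⟩ | ⟨Q, hq', hq1, hq2, hq3⟩ := hcases q hq <;>
  obtain ⟨R, hr', hr1, hr2, hr3⟩ | ⟨R, hr', hr1, hr2, hr3⟩ := hcases r hr <;>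
  simp only [hp1, hq1, hr1, or_true, or_false, iff_true, true_iff, not_true] at hpar <;>
  simp only [hp2, hp3, hq2, hq3, hr2, hr3, hpar, if_false, ite_self] <;>
  simp only [hp', hq', hr', Nat.add_sub_cancel, Nat.reduceSubDiff] <;>
  refine (Nat.div_eq_of_eq_mul_left (by norm_num) ?_).symm <;>
  ring

end Brieskorn

/-- The set of conjugacy classes of irreducible `SL₂(ℂ)` representations of the
fundamental group of the Brieskorn sphere `Σ(p,q,r)` is finite of cardinality
`(p-1)(q-1)(r-1)/4`. -/
theorem brieskorn_card_irreducible_conj_classes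
    (p q r : ℕ) (hp : 0 < p) (hq : 0 < q) (hr : 0 < r)
    (hpq : Nat.Coprime p q) (hpr : Nat.Coprime p r) (hqr : Nat.Coprime q r)
    (a b c : ℤ) (habc : a * q * r + b * p * r + c * p * q = 1) :
    Finite (Quot (ConjRel (G := PresentedGroup (brieskornRels p q r a b c)))) ∧
      Nat.card (Quot (ConjRel (G := PresentedGroup (brieskornRels p q r a b c)))) =
        (p - 1) * (q - 1) * (r - 1) / 4 := by
  let F : Quot (ConjRel (G := PresentedGroup (brieskornRels p q r a b c))) → Fin 4 → ℂ :=
    Quot.lift (fun ρ => generatorTraces ρ.1)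
      fun ρ₁ ρ₂ h => (conjRel_iff_generatorTraces_eq ρ₁ ρ₂).mp h
  have hF : Function.Injective F := by
    rintro ⟨ρ₁⟩ ⟨ρ₂⟩ h
    exact Quot.sound ((conjRel_iff_generatorTraces_eq ρ₁ ρ₂).mpr h)
  have hrange : Set.range F =
      ((repIndices p q r a b c).image (indexTraces p q r) : Set (Fin 4 → ℂ)) := by
    ext t
    simp only [Set.mem_range, Finset.mem_coe, Finset.mem_image]
    constructor
    · rintro ⟨⟨ρ⟩, rfl⟩
      exact exists_index_of_irreducible hp hq hr ρ.2
    · rintro ⟨x, hx, rfl⟩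
      obtain ⟨ρ, hρ, h⟩ := exists_irreducible_of_index hpq hpr hx
      exact ⟨Quot.mk _ ⟨ρ, hρ⟩, h⟩
  have hfin : (Set.range F).Finite := hrange ▸ Finset.finite_toSet _
  have : Finite (Set.range F) := hfin
  refine ⟨Finite.of_injective_finite_range hF, ?_⟩
  rw [← Nat.card_range_of_injective hF, hrange, Nat.card_coe_set_eq, Set.ncard_coe_finset,
    Finset.card_image_of_injOn indexTraces_injOn, card_repIndices hp hq hr habc]
end

section
/- Fix an integer ξ ≥ 1. In the free group on two generators x, y, define the word w_ξ = (y x⁻¹ y⁻¹ x)^{ξ/2} if ξ is even and w_ξ = (y x y⁻¹ x⁻¹)^{(ξ−1)/2} y x if ξ is odd; let w*_ξ denote the word obtained from w_ξ by reversing the order of its letters, namely w*_ξ = (x y⁻¹ x⁻¹ y)^{ξ/2} if ξ is even and w*_ξ = x y (x⁻¹ y⁻¹ x y)^{(ξ−1)/2} if ξ is odd; and set λ_ξ = w_ξ w*_ξ if ξ is even and λ_ξ = x⁻⁴ w_ξ w*_ξ if ξ is odd. Let G_ξ be the group with presentation ⟨x, y | x w_ξ = w_ξ y⟩ (the fundamental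 group of the complement of the ξ-twist knot, with meridian x and longitude λ_ξ). Then for every irreducible representation ρ : G_ξ → SL₂(ℂ) with tr ρ(x) ∈ {2, −2} and tr ρ(λ_ξ) ∈ {2, −2}, and for all relatively prime integers p and q, we have ρ(x)^p ρ(λ_ξ)^q ≠ I. -/
namespace TwistKnot

/-- The generator `x` (the meridian) of the free group on two generators. -/
def x : FreeGroup (Fin 2) := FreeGroup.of 0

/-- The generator `y` of the free group on two generators. -/
def y : FreeGroup (Fin 2) := FreeGroup.of 1

/-- The word `w_ξ`: `(y x⁻¹ y⁻¹ x)^{ξ/2}` for `ξ` even, and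
`(y x y⁻¹ x⁻¹)^{(ξ-1)/2} y x` for `ξ` odd. -/
def w (ξ : ℕ) : FreeGroup (Fin 2) :=
  if Even ξ then (y * x⁻¹ * y⁻¹ * x) ^ (ξ / 2)
  else (y * x * y⁻¹ * x⁻¹) ^ ((ξ - 1) / 2) * y * x

/-- The reversed word `w*_ξ`: `(x y⁻¹ x⁻¹ y)^{ξ/2}` for `ξ` even, and
`x y (x⁻¹ y⁻¹ x y)^{(ξ-1)/2}` for `ξ` odd. -/
def wStar (ξ : ℕ) : FreeGroup (Fin 2) :=
  if Even ξ then (x * y⁻¹ * x⁻¹ * y) ^ (ξ / 2)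
  else x * y * (x⁻¹ * y⁻¹ * x * y) ^ ((ξ - 1) / 2)

/-- The longitude word `λ_ξ`: `w_ξ w*_ξ` for `ξ` even and `x⁻⁴ w_ξ w*_ξ` for `ξ` odd. -/
def lam (ξ : ℕ) : FreeGroup (Fin 2) :=
  if Even ξ then w ξ * wStar ξ else x⁻¹ ^ 4 * w ξ * wStar ξ

/-- The single relation `x w_ξ = w_ξ y` of the twist knot group
`G_ξ = ⟨x, y ∣ x w_ξ = w_ξ y⟩`. -/
def rels (ξ : ℕ) : Set (FreeGroup (Fin 2)) :=
  {x * w ξ * (w ξ * y)⁻¹}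

end TwistKnot

namespace TwistKnot

open Matrix Polynomial

/-- The upper unitriangular matrix with off-diagonal entry `t`. -/
def upper {R : Type*} [CommRing R] (t : R) : SpecialLinearGroup (Fin 2) R :=
  ⟨!![1, t; 0, 1], by simp [det_fin_two]⟩

/-- The lower unitriangular matrix with off-diagonal entry `t`. -/
def lower {R : Type*} [CommRing R] (t : R) : SpecialLinearGroup (Fin 2) R :=
  ⟨!![1, 0; t, 1], by simp [det_fin_two]⟩

section Ring

variable {R : Type*} [CommRing R]

lemma coe_upper (t : R) : (upper t : Matrix (Fin 2) (Fin 2) R) = !![1, t; 0, 1] := rfl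

lemma coe_lower (t : R) : (lower t : Matrix (Fin 2) (Fin 2) R) = !![1, 0; t, 1] := rfl

lemma upper_mul (s t : R) : upper s * upper t = upper (s + t) := by
  ext i j
  fin_cases i <;> fin_cases j <;> simp [coe_upper, add_comm]

lemma upper_zero : upper (0 : R) = 1 := by
  ext i j
  fin_cases i <;> fin_cases j <;> simp [coe_upper]

lemma upper_inv (t : R) : (upper t)⁻¹ = upper (-t) :=
  inv_eq_of_mul_eq_one_right (by rw [upper_mul, add_neg_cancel, upper_zero])

lemma lower_inv (t : R) : (lower t)⁻¹ = lower (-t) := by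
  apply inv_eq_of_mul_eq_one_right
  ext i j
  fin_cases i <;> fin_cases j <;> simp [coe_lower]

lemma upper_pow (t : R) (n : ℕ) : upper t ^ n = upper (n * t) := by
  induction n with
  | zero => simp [upper_zero]
  | succ n ih => rw [pow_succ, ih, upper_mul]; congr 1; push_cast; ring

lemma upper_zpow (t : R) (n : ℤ) : upper t ^ n = upper (n * t) := by
  cases n with
  | ofNat n => simp [upper_pow]
  | negSucc n => rw [zpow_negSucc, upper_pow, upper_inv]; congr 1; push_cast; ring

lemma map_upper {S : Type*} [CommRing S] (f : R →+* S) (t : R) :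
    SpecialLinearGroup.map f (upper t) = upper (f t) := by
  ext i j
  fin_cases i <;> fin_cases j <;> simp [coe_upper]

lemma map_lower {S : Type*} [CommRing S] (f : R →+* S) (t : R) :
    SpecialLinearGroup.map f (lower t) = lower (f t) := by
  ext i j
  fin_cases i <;> fin_cases j <;> simp [coe_lower]

/-- The anti-automorphism of `SL₂` swapping the diagonal entries. It fixes all unitriangular
matrices, hence sends a word in them to the reversed word. -/
def swapDiag (M : SpecialLinearGroup (Fin 2) R) : SpecialLinearGroup (Fin 2) R :=
  ⟨!![M 1 1, M 0 1; M 1 0, M 0 0], by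
    have := M.det_coe
    rw [det_fin_two] at this
    rw [det_fin_two_of]
    linear_combination this⟩

lemma coe_swapDiag (M : SpecialLinearGroup (Fin 2) R) :
    (swapDiag M : Matrix (Fin 2) (Fin 2) R) = !![M 1 1, M 0 1; M 1 0, M 0 0] := rfl

lemma swapDiag_mul (M N : SpecialLinearGroup (Fin 2) R) :
    swapDiag (M * N) = swapDiag N * swapDiag M := by
  ext i j
  fin_cases i <;> fin_cases j <;> simp [coe_swapDiag, Matrix.mul_apply, Fin.sum_univ_two] <;> ring

lemma swapDiag_pow (M : SpecialLinearGroup (Fin 2) R) (n : ℕ) :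
    swapDiag (M ^ n) = swapDiag M ^ n := by
  induction n with
  | zero =>
    ext i j
    fin_cases i <;> fin_cases j <;> simp [coe_swapDiag]
  | succ n ih => rw [pow_succ, swapDiag_mul, ih, pow_succ']

lemma swapDiag_upper (t : R) : swapDiag (upper t) = upper t := by
  ext i j
  fin_cases i <;> fin_cases j <;> simp [coe_swapDiag, coe_upper]

lemma swapDiag_lower (t : R) : swapDiag (lower t) = lower t := by
  ext i j
  fin_cases i <;> fin_cases j <;> simp [coe_swapDiag, coe_lower]

end Ring

/-- The parabolic representation of the free group sending `x` to `upper 1` and `y` to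
`lower (-u)`. -/
noncomputable def parabolic {R : Type*} [CommRing R] (u : R) :
    FreeGroup (Fin 2) →* SpecialLinearGroup (Fin 2) R :=
  FreeGroup.lift ![upper 1, lower (-u)]

section Parabolic

variable {R : Type*} [CommRing R] (u : R)

lemma parabolic_x : parabolic u x = upper 1 := by simp [parabolic, x]

lemma parabolic_y : parabolic u y = lower (-u) := by simp [parabolic, y]

lemma parabolic_wStar (ξ : ℕ) : parabolic u (wStar ξ) = swapDiag (parabolic u (w ξ)) := by
  unfold w wStar
  split_ifs <;>
    simp only [map_mul, map_pow, map_inv, parabolic_x, parabolic_y, swapDiag_mul, swapDiag_pow,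
      upper_inv, lower_inv, swapDiag_upper, swapDiag_lower, mul_assoc]

lemma map_parabolic {S : Type*} [CommRing S] (f : R →+* S) (g : FreeGroup (Fin 2)) :
    SpecialLinearGroup.map f (parabolic u g) = parabolic (f u) g := by
  have h : (SpecialLinearGroup.map f).comp (parabolic u) = parabolic (f u) := by
    apply FreeGroup.ext_hom
    intro i
    fin_cases i <;> simp [parabolic, map_upper, map_lower]
  exact DFunLike.congr_fun h g

end Parabolic

/-- The bottom row of `M` consists of values at `u` of integer polynomials of degree at most `n`,
the second of which has a unit as its coefficient of degree `n`. -/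
def HasUnitLeading (u : ℂ) (n : ℕ) (M : SL2C) : Prop :=
  ∃ c d : ℤ[X], c.natDegree ≤ n ∧ d.natDegree ≤ n ∧ IsUnit (d.coeff n) ∧
    aeval u c = M 1 0 ∧ aeval u d = M 1 1

lemma hasUnitLeading_one (u : ℂ) : HasUnitLeading u 0 1 :=
  ⟨0, 1, by simp, by simp, by simp, by simp, by simp⟩

lemma HasUnitLeading.mul {u : ℂ} {n : ℕ} {M : SL2C} (h : HasUnitLeading u n M)
    {e f : ℤ} (he : IsUnit e) (hf : IsUnit f) :
    HasUnitLeading u (n + 1) (M * lower (-(f * u)) * upper (e : ℂ)) := by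
  obtain ⟨c, d, hc, hd, hu, hcM, hdM⟩ := h
  have hcd : (c - C f * (X * d)).natDegree ≤ n + 1 := by
    refine (natDegree_sub_le _ _).trans (max_le (by omega) ?_)
    refine (natDegree_C_mul_le _ _).trans (natDegree_mul_le.trans ?_)
    have := natDegree_X_le (R := ℤ)
    omega
  refine ⟨c - C f * (X * d), C e * (c - C f * (X * d)) + d, hcd, ?_, ?_, ?_, ?_⟩
  · exact (natDegree_add_le _ _).trans
      (max_le ((natDegree_C_mul_le _ _).trans hcd) (by omega))
  · have h1 : c.coeff (n + 1) = 0 := coeff_eq_zero_of_natDegree_lt (by omega)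
    have h2 : d.coeff (n + 1) = 0 := coeff_eq_zero_of_natDegree_lt (by omega)
    simpa [h1, h2, coeff_X_mul] using ⟨he, hf, hu⟩
  · simp [coe_lower, coe_upper, Matrix.mul_apply, Fin.sum_univ_two, hcM, hdM]
    ring
  · simp [coe_lower, coe_upper, Matrix.mul_apply, Fin.sum_univ_two, hcM, hdM]
    ring

lemma HasUnitLeading.isIntegral {u : ℂ} {n : ℕ} {M : SL2C} (h : HasUnitLeading u n M)
    (hM : M 1 1 = 0) : IsIntegral ℤ u := by
  obtain ⟨c, d, -, hd, hu, -, hdM⟩ := h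
  have hroot : aeval u d = 0 := hdM.trans hM
  obtain h1 | h1 := Int.isUnit_iff.mp hu
  · exact ⟨d, monic_of_natDegree_le_of_coeff_eq_one n hd h1, hroot⟩
  · refine ⟨-d, monic_of_natDegree_le_of_coeff_eq_one n (by simpa using hd) (by simp [h1]), ?_⟩
    rw [← aeval_def, map_neg, hroot, neg_zero]

lemma hasUnitLeading_w (u : ℂ) (ξ : ℕ) : ∃ n, HasUnitLeading u n (parabolic u (w ξ)) := by
  have h1 : IsUnit (1 : ℤ) := isUnit_one
  have h2 : IsUnit (-1 : ℤ) := isUnit_one.neg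
  have hpow (M : SL2C) (hM : ∀ n N, HasUnitLeading u n N → HasUnitLeading u (n + 2) (N * M))
      (k : ℕ) : HasUnitLeading u (2 * k) (M ^ k) := by
    induction k with
    | zero => simpa using hasUnitLeading_one u
    | succ k ih => simpa [pow_succ, mul_add] using hM _ _ ih
  unfold w
  split_ifs
  · refine ⟨2 * (ξ / 2), ?_⟩
    rw [map_pow]
    refine hpow _ (fun n N hN => ?_) _
    simpa [parabolic_x, parabolic_y, upper_inv, lower_inv, mul_assoc]
      using (hN.mul h2 h1).mul h1 h2
  · refine ⟨2 * ((ξ - 1) / 2) + 1, ?_⟩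
    rw [map_mul, map_mul, map_pow, parabolic_x, parabolic_y]
    have hw : HasUnitLeading u (2 * ((ξ - 1) / 2))
        (parabolic u (y * x * y⁻¹ * x⁻¹) ^ ((ξ - 1) / 2)) := by
      refine hpow _ (fun n N hN => ?_) _
      simpa [parabolic_x, parabolic_y, upper_inv, lower_inv, mul_assoc]
        using (hN.mul h1 h1).mul h2 h2
    simpa using hw.mul h1 h1

lemma isIntegral_parabolic_apply {u : ℂ} (hu : IsIntegral ℤ u) (g : FreeGroup (Fin 2))
    (i j : Fin 2) : IsIntegral ℤ (parabolic u g i j) := by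
  have h := map_parabolic (⟨u, hu⟩ : integralClosure ℤ ℂ)
    (algebraMap (integralClosure ℤ ℂ) ℂ) g
  have hij : parabolic u g i j =
      ((parabolic (⟨u, hu⟩ : integralClosure ℤ ℂ) g i j : integralClosure ℤ ℂ) : ℂ) := by
    change parabolic (algebraMap (integralClosure ℤ ℂ) ℂ ⟨u, hu⟩) g i j = _
    rw [← h]
    rfl
  rw [hij]
  exact (parabolic (⟨u, hu⟩ : integralClosure ℤ ℂ) g i j).2

/-- The longitude of a parabolic representation of a twist knot group is minus a unipotent matrix
whose translation length is twice an algebraic integer. -/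
lemma exists_parabolic_lam (u : ℂ) (ξ : ℕ)
    (hrel : parabolic u (x * w ξ) = parabolic u (w ξ * y)) :
    ∃ σ : ℂ, IsIntegral ℤ σ ∧ parabolic u (lam ξ) = -upper (2 * σ) := by
  have h01 := congrArg (fun M : SL2C => M 0 1) hrel
  have hdet := (parabolic u (w ξ)).det_coe
  simp [parabolic_x, parabolic_y, coe_upper, coe_lower, Matrix.mul_apply, Fin.sum_univ_two] at h01
  obtain ⟨n, hn⟩ := hasUnitLeading_w u ξ
  have hu := hn.isIntegral h01
  have ha := isIntegral_parabolic_apply hu (w ξ) 0 0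
  have hb := isIntegral_parabolic_apply hu (w ξ) 0 1
  have hlam : parabolic u (w ξ) * parabolic u (wStar ξ) =
      -upper (2 * -(parabolic u (w ξ) 0 0 * parabolic u (w ξ) 0 1)) := by
    rw [parabolic_wStar]
    rw [det_fin_two, h01] at hdet
    ext i j
    fin_cases i <;> fin_cases j <;>
      simp [coe_swapDiag, coe_upper, Matrix.mul_apply, Fin.sum_univ_two, h01]
    · linear_combination -hdet
    · ring
    · linear_combination -hdet
  unfold lam
  split_ifs
  · exact ⟨_, (ha.mul hb).neg, by rw [map_mul, hlam]⟩
  · refine ⟨-2 + -(parabolic u (w ξ) 0 0 * parabolic u (w ξ) 0 1), ?_, ?_⟩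
    · exact (by simpa using (isIntegral_algebraMap (R := ℤ) (A := ℂ) (x := -2)) :
        IsIntegral ℤ (-2 : ℂ)).add (ha.mul hb).neg
    · rw [mul_assoc, map_mul, map_mul, hlam, map_pow, map_inv, parabolic_x, upper_inv, upper_pow,
        mul_neg, upper_mul]
      congr 2
      push_cast
      ring

/-- Two matrices in `SL₂(ℂ)` of trace `2` with no common eigenvector can be simultaneously
conjugated to `upper 1` and `lower (-u)`. -/
lemma exists_conj_eq_upper_lower (A B : SL2C) (hA : (A : Matrix (Fin 2) (Fin 2) ℂ).trace = 2)
    (hB : (B : Matrix (Fin 2) (Fin 2) ℂ).trace = 2)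
    (hAB : ∀ v : Fin 2 → ℂ, v ≠ 0 → (∃ c : ℂ, A.1 *ᵥ v = c • v) → ¬ ∃ c : ℂ, B.1 *ᵥ v = c • v) :
    ∃ (P : SL2C) (u : ℂ), P⁻¹ * A * P = upper 1 ∧ P⁻¹ * B * P = lower (-u) := by
  have hdA := A.det_coe
  have hdB := B.det_coe
  rw [det_fin_two] at hdA hdB
  rw [trace_fin_two] at hA hB
  obtain ⟨v, hv0, hv⟩ : ∃ v : Fin 2 → ℂ, v ≠ 0 ∧ (B.1 - 1) *ᵥ v = 0 := by
    rw [Matrix.exists_mulVec_eq_zero_iff, det_fin_two]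
    simp
    linear_combination hdB - hB
  have hv' : B.1 *ᵥ v = v := by rwa [sub_mulVec, one_mulVec, sub_eq_zero] at hv
  have hB0 := congrFun hv' 0
  have hB1 := congrFun hv' 1
  simp only [mulVec, dotProduct, Fin.sum_univ_two] at hB0 hB1
  set D : ℂ := (A.1 0 0 * v 0 + A.1 0 1 * v 1) * v 1 - (A.1 1 0 * v 0 + A.1 1 1 * v 1) * v 0
    with hD
  have hD0 : D ≠ 0 := by
    intro h
    refine hAB v hv0 ?_ ⟨1, by rw [hv', one_smul]⟩
    by_cases h1 : v 1 = 0
    · have h0 : v 0 ≠ 0 := by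
        intro h0
        apply hv0
        ext i
        fin_cases i <;> simp [h0, h1]
      refine ⟨(A.1 0 0 * v 0 + A.1 0 1 * v 1) / v 0, ?_⟩
      ext i
      fin_cases i <;> simp [mulVec, dotProduct, Fin.sum_univ_two] <;> field_simp
      linear_combination hD - h
    · refine ⟨(A.1 1 0 * v 0 + A.1 1 1 * v 1) / v 1, ?_⟩
      ext i
      fin_cases i <;> simp [mulVec, dotProduct, Fin.sum_univ_two] <;> field_simp
      linear_combination h - hD
  obtain ⟨k, hk⟩ := IsAlgClosed.exists_pow_nat_eq (D⁻¹) (n := 2) (by norm_num)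
  have hkD : k ^ 2 * D = 1 := by rw [hk, inv_mul_cancel₀ hD0]
  obtain ⟨P, hP⟩ : ∃ P : SL2C, P.1 = !![k * (A.1 0 0 * v 0 + A.1 0 1 * v 1 - v 0), k * v 0;
      k * (A.1 1 0 * v 0 + A.1 1 1 * v 1 - v 1), k * v 1] :=
    ⟨⟨_, by
      rw [det_fin_two_of]
      linear_combination hkD - k ^ 2 * hD⟩, rfl⟩
  refine ⟨P, -((P⁻¹ * B * P) 1 0), ?_, ?_⟩
  · rw [mul_assoc, inv_mul_eq_iff_eq_mul]
    have h11 : A.1 1 1 = 2 - A.1 0 0 := by linear_combination hA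
    rw [h11] at hdA
    ext i j
    fin_cases i <;> fin_cases j <;>
      simp [hP, coe_upper, Matrix.mul_apply, Fin.sum_univ_two, h11]
    · linear_combination (-k * v 0) * hdA
    · ring
    · linear_combination (-k * v 1) * hdA
    · ring
  · have hcol : P⁻¹ * B * P = P⁻¹ * (B * P) := mul_assoc _ _ _
    have hBP0 : (B * P) 0 1 = k * v 0 := by
      simp [hP, Matrix.mul_apply, Fin.sum_univ_two]
      linear_combination k * hB0
    have hBP1 : (B * P) 1 1 = k * v 1 := by
      simp [hP, Matrix.mul_apply, Fin.sum_univ_two]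
      linear_combination k * hB1
    have e01 : (P⁻¹ * B * P) 0 1 = 0 := by
      rw [hcol, Matrix.SpecialLinearGroup.coe_mul, Matrix.mul_apply, Fin.sum_univ_two, hBP0, hBP1]
      simp [hP, Matrix.SpecialLinearGroup.coe_inv, adjugate_fin_two]
      ring
    have e11 : (P⁻¹ * B * P) 1 1 = 1 := by
      rw [hcol, Matrix.SpecialLinearGroup.coe_mul, Matrix.mul_apply, Fin.sum_univ_two, hBP0, hBP1]
      simp [hP, Matrix.SpecialLinearGroup.coe_inv, adjugate_fin_two]
      linear_combination hkD - k ^ 2 * hD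
    have e00 : (P⁻¹ * B * P) 0 0 = 1 := by
      have := (P⁻¹ * B * P).det_coe
      rw [det_fin_two, e01, e11] at this
      linear_combination this
    ext i j
    fin_cases i <;> fin_cases j
    · simpa [coe_lower] using e00
    · simpa [coe_lower] using e01
    · simp [coe_lower]
    · simpa [coe_lower] using e11

lemma even_and_odd_of_add_eq_zero {p q : ℤ} (hpq : IsCoprime p q) {σ : ℂ} (hσ : IsIntegral ℤ σ)
    (h : (p : ℂ) + q * (2 * σ) = 0) : Even p ∧ Odd q := by
  have hq : q ≠ 0 := by
    rintro rfl
    have hp : p = 0 := by simpa using h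
    subst hp
    exact not_isCoprime_zero_zero hpq
  have hqC : (q : ℂ) ≠ 0 := by exact_mod_cast hq
  have hrat : algebraMap ℚ ℂ (-p / (2 * q)) = σ := by
    simp
    field_simp
    linear_combination -h
  rw [← hrat, isIntegral_algebraMap_iff (algebraMap ℚ ℂ).injective] at hσ
  obtain ⟨m, hm⟩ := IsIntegrallyClosed.isIntegral_iff.mp hσ
  rw [← hrat, ← hm] at h
  have hp : p + q * (2 * m) = 0 := by
    simp at h
    exact_mod_cast h
  have hpe : Even p := ⟨-(q * m), by linear_combination hp⟩
  refine ⟨hpe, ?_⟩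
  by_contra hqo
  rw [Int.not_odd_iff_even] at hqo
  have := hpq.isUnit_of_dvd' hpe.two_dvd hqo.two_dvd
  simp [Int.isUnit_iff] at this

lemma upper_zpow_mul_neg_upper_zpow_ne_one {A : SL2C} (hA : A = upper 1 ∨ A = -upper 1) {σ : ℂ}
    (hσ : IsIntegral ℤ σ) {p q : ℤ} (hpq : IsCoprime p q) :
    A ^ p * (-upper (2 * σ)) ^ q ≠ 1 := by
  intro h
  have hA' : A ^ p = upper (p : ℂ) ∨ A ^ p = -upper (p : ℂ) := by
    rcases hA with rfl | rfl
    · simp [upper_zpow]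
    · rcases Int.even_or_odd p with hp | hp
      · simp [hp.neg_zpow, upper_zpow]
      · simp [hp.neg_zpow, upper_zpow]
  have hB : (-upper (2 * σ)) ^ q = upper (q * (2 * σ)) ∨
      (-upper (2 * σ)) ^ q = -upper (q * (2 * σ)) := by
    rcases Int.even_or_odd q with hq | hq
    · simp [hq.neg_zpow, upper_zpow]
    · simp [hq.neg_zpow, upper_zpow]
  have hsum : (p : ℂ) + q * (2 * σ) = 0 := by
    have h01 := congrArg (fun M : SL2C => M 0 1) h
    rcases hA' with h1 | h1 <;> rcases hB with h2 | h2 <;> rw [h1, h2] at h01 <;>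
      simp [coe_upper] at h01
    all_goals first | linear_combination h01 | linear_combination -h01
  obtain ⟨hp, hq⟩ := even_and_odd_of_add_eq_zero hpq hσ hsum
  have hAp : A ^ p = upper (p : ℂ) := by
    rcases hA with rfl | rfl <;> simp [hp.neg_zpow, upper_zpow]
  rw [hAp, hq.neg_zpow, upper_zpow, mul_neg, upper_mul, hsum, upper_zero] at h
  have h00 := congrArg (fun M : SL2C => M 0 0) h
  norm_num at h00

lemma map_w_of_neg {φ ψ : FreeGroup (Fin 2) →* SL2C} (hx : φ x = -ψ x) (hy : φ y = -ψ y)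
    (ξ : ℕ) : φ (w ξ) = ψ (w ξ) := by
  unfold w
  split_ifs <;> simp [hx, hy]

lemma map_lam_of_neg {φ ψ : FreeGroup (Fin 2) →* SL2C} (hx : φ x = -ψ x) (hy : φ y = -ψ y)
    (ξ : ℕ) : φ (lam ξ) = ψ (lam ξ) := by
  have hs : φ (wStar ξ) = ψ (wStar ξ) := by
    unfold wStar
    split_ifs <;> simp [hx, hy]
  unfold lam
  split_ifs <;> simp [map_w_of_neg hx hy, hs, hx, Even.neg_pow (by decide : Even 4)]

lemma eq_parabolic {φ : FreeGroup (Fin 2) →* SL2C} {u : ℂ} (hx : φ x = upper 1)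
    (hy : φ y = lower (-u)) : φ = parabolic u := by
  apply FreeGroup.ext_hom
  intro i
  fin_cases i
  · exact hx.trans (parabolic_x u).symm
  · exact hy.trans (parabolic_y u).symm

/-- A homomorphism from the free group with no common eigenvector of the images of `x` and `y`,
satisfying the twist knot relation, sends no nontrivial slope to the identity. -/
lemma zpow_mul_zpow_ne_one (ξ : ℕ) (φ : FreeGroup (Fin 2) →* SL2C)
    (hφ : ∀ v : Fin 2 → ℂ, v ≠ 0 → (∃ c : ℂ, (φ x).1 *ᵥ v = c • v) →
      ¬ ∃ c : ℂ, (φ y).1 *ᵥ v = c • v)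
    (hrel : φ (x * w ξ) = φ (w ξ * y))
    (hmer : (φ x : Matrix (Fin 2) (Fin 2) ℂ).trace = 2 ∨
      (φ x : Matrix (Fin 2) (Fin 2) ℂ).trace = -2)
    {p q : ℤ} (hpq : IsCoprime p q) : φ x ^ p * φ (lam ξ) ^ q ≠ 1 := by
  have hy : φ y = (φ (w ξ))⁻¹ * φ x * φ (w ξ) := by
    rw [mul_assoc, ← map_mul φ x, hrel, map_mul, inv_mul_cancel_left]
  have htr : (φ y : Matrix (Fin 2) (Fin 2) ℂ).trace = (φ x : Matrix (Fin 2) (Fin 2) ℂ).trace := by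
    rw [hy, Matrix.SpecialLinearGroup.coe_mul, Matrix.trace_mul_comm,
      ← Matrix.SpecialLinearGroup.coe_mul, mul_inv_cancel_left]
  suffices h : ∃ (P : SL2C) (σ : ℂ), IsIntegral ℤ σ ∧
      (P⁻¹ * φ x * P = upper 1 ∨ P⁻¹ * φ x * P = -upper 1) ∧
      P⁻¹ * φ (lam ξ) * P = -upper (2 * σ) by
    obtain ⟨P, σ, hσ, hx, hl⟩ := h
    intro h1
    apply upper_zpow_mul_neg_upper_zpow_ne_one hx hσ hpq
    rw [← hl]
    have hc (M : SL2C) (n : ℤ) : (P⁻¹ * M * P) ^ n = P⁻¹ * M ^ n * P := by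
      simpa using conj_zpow (a := P⁻¹) (b := M) (i := n)
    calc (P⁻¹ * φ x * P) ^ p * (P⁻¹ * φ (lam ξ) * P) ^ q
        = P⁻¹ * (φ x ^ p * φ (lam ξ) ^ q) * P := by rw [hc, hc]; group
      _ = 1 := by rw [h1]; group
  rcases hmer with h2 | h2
  · obtain ⟨P, u, hPx, hPy⟩ := exists_conj_eq_upper_lower (φ x) (φ y) h2 (htr.trans h2) hφ
    let ψ : FreeGroup (Fin 2) →* SL2C := (MulAut.conj P⁻¹).toMonoidHom.comp φ
    have hψ (g) : ψ g = P⁻¹ * φ g * P := by simp [ψ]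
    have hψu : ψ = parabolic u := eq_parabolic (by rw [hψ, hPx]) (by rw [hψ, hPy])
    obtain ⟨σ, hσ, hl⟩ := exists_parabolic_lam u ξ (by rw [← hψu, hψ, hψ, hrel])
    exact ⟨P, σ, hσ, .inl hPx, by rw [← hψ, hψu, hl]⟩
  · obtain ⟨P, u, hPx, hPy⟩ := exists_conj_eq_upper_lower (-φ x) (-φ y)
      (by simp [h2]) (by simp [htr, h2]) (by
        intro v hv hx hy
        apply hφ v hv
        · obtain ⟨c, hc⟩ := hx
          exact ⟨-c, by
            rwa [Matrix.SpecialLinearGroup.coe_neg, neg_mulVec, neg_eq_iff_eq_neg, ← neg_smul] at hc⟩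
        · obtain ⟨c, hc⟩ := hy
          exact ⟨-c, by
            rwa [Matrix.SpecialLinearGroup.coe_neg, neg_mulVec, neg_eq_iff_eq_neg, ← neg_smul] at hc⟩)
    let ψ : FreeGroup (Fin 2) →* SL2C := (MulAut.conj P⁻¹).toMonoidHom.comp φ
    have hψ (g) : ψ g = P⁻¹ * φ g * P := by simp [ψ]
    have hψx : ψ x = -parabolic u x := by
      rw [hψ, parabolic_x, ← hPx]
      simp
    have hψy : ψ y = -parabolic u y := by
      rw [hψ, parabolic_y, ← hPy]
      simp
    have hw := map_w_of_neg hψx hψy ξ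
    obtain ⟨σ, hσ, hl⟩ := exists_parabolic_lam u ξ (by
      have h : ψ (x * w ξ) = ψ (w ξ * y) := by rw [hψ, hψ, hrel]
      simpa [hψx, hψy, hw] using h)
    refine ⟨P, σ, hσ, .inr ?_, ?_⟩
    · rw [← hψ, hψx, parabolic_x]
    · rw [← hψ, map_lam_of_neg hψx hψy, hl]

/-- A common eigenvector of the images of the generators is an eigenvector of every element. -/
lemma exists_mulVec_eq_smul {G : Type*} [Group G] (φ : G →* SL2C) (S : Set G)
    (hS : Subgroup.closure S = ⊤) {v : Fin 2 → ℂ}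
    (hv : ∀ s ∈ S, ∃ c : ℂ, (φ s).1 *ᵥ v = c • v) (g : G) : ∃ c : ℂ, (φ g).1 *ᵥ v = c • v := by
  have hg : g ∈ Subgroup.closure S := by rw [hS]; trivial
  induction hg using Subgroup.closure_induction with
  | mem s hs => exact hv s hs
  | one => exact ⟨1, by simp⟩
  | mul a b _ _ ha hb =>
    obtain ⟨c, hc⟩ := ha
    obtain ⟨d, hd⟩ := hb
    refine ⟨d * c, ?_⟩
    rw [map_mul]
    change ((φ a).1 * (φ b).1) *ᵥ v = _
    rw [← mulVec_mulVec, hd, mulVec_smul, hc, smul_smul]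
  | inv a _ ha =>
    obtain ⟨c, hc⟩ := ha
    have hinv : (φ a⁻¹).1 *ᵥ ((φ a).1 *ᵥ v) = v := by
      rw [mulVec_mulVec, ← Matrix.SpecialLinearGroup.coe_mul, ← map_mul]
      simp
    rw [hc, mulVec_smul] at hinv
    by_cases hc0 : c = 0
    · refine ⟨0, ?_⟩
      rw [hc0, zero_smul] at hinv
      simp [← hinv]
    · exact ⟨c⁻¹, by rw [eq_inv_smul_iff₀ hc0, hinv]⟩

end TwistKnot

/-- Every slope of a nontrivial twist knot is regular: for every irreducible
`SL₂(ℂ)` representation `ρ` of the twist knot group with `tr ρ(μ) = ±2` and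
`tr ρ(λ) = ±2`, and all coprime integers `p, q`, we have `ρ(μ)^p ρ(λ)^q ≠ I`. -/
theorem twist_knot_all_slopes_regular (ξ : ℕ) (hξ : 1 ≤ ξ)
    (ρ : PresentedGroup (TwistKnot.rels ξ) →* SL2C) (hρ : IsIrreducibleRep ρ)
    (hmer : Matrix.trace ((ρ (PresentedGroup.mk (TwistKnot.rels ξ) TwistKnot.x) :
        Matrix (Fin 2) (Fin 2) ℂ)) = 2 ∨
      Matrix.trace ((ρ (PresentedGroup.mk (TwistKnot.rels ξ) TwistKnot.x) :
        Matrix (Fin 2) (Fin 2) ℂ)) = -2)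
    (hlong : Matrix.trace ((ρ (PresentedGroup.mk (TwistKnot.rels ξ) (TwistKnot.lam ξ)) :
        Matrix (Fin 2) (Fin 2) ℂ)) = 2 ∨
      Matrix.trace ((ρ (PresentedGroup.mk (TwistKnot.rels ξ) (TwistKnot.lam ξ)) :
        Matrix (Fin 2) (Fin 2) ℂ)) = -2)
    (p q : ℤ) (hpq : IsCoprime p q) :
    ρ (PresentedGroup.mk (TwistKnot.rels ξ) TwistKnot.x) ^ p *
      ρ (PresentedGroup.mk (TwistKnot.rels ξ) (TwistKnot.lam ξ)) ^ q ≠ 1 := by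
  have hrel : PresentedGroup.mk (TwistKnot.rels ξ) (TwistKnot.x * TwistKnot.w ξ) =
      PresentedGroup.mk (TwistKnot.rels ξ) (TwistKnot.w ξ * TwistKnot.y) := by
    rw [← mul_inv_eq_one, ← map_inv, ← map_mul]
    exact PresentedGroup.one_of_mem rfl
  refine TwistKnot.zpow_mul_zpow_ne_one ξ (ρ.comp (PresentedGroup.mk (TwistKnot.rels ξ)))
    (fun v hv hx hy => hρ ⟨v, hv, ?_⟩) (congrArg ρ hrel) hmer hpq
  refine TwistKnot.exists_mulVec_eq_smul ρ _ (PresentedGroup.closure_range_of _) ?_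
  rintro _ ⟨i, rfl⟩
  fin_cases i
  · exact hx
  · exact hy
end
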